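/- Let A be a unital C*-algebra and let a ∈ A. Then 0 ∈ D_A(a) if and only if both of the following hold: (a) τ(a) = 0 for all tracial states τ of A; (b) for no proper closed two-sided ideal I of A and no complex number w is the image of Re(wa) = (wa + (wa)*)/2 in the quotient A/I invertible with negative spectrum. -/

import Mathlib

open scoped ComplexOrder

noncomputable section

universe u

variable {A : Type u} [CStarAlgebra A]

/-- A tracial state on a C*-algebra: a positive linear functional of norm 1 with the trace
property. -/
def IsTracialState (τ : A →L[ℂ] ℂ) : Prop :=
  ‖τ‖ = 1 ∧ (∀ a : A, 0 ≤ τ (star a * a)) ∧ ∀ a b : A, τ (a * b) = τ (b * a)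

/-- The Dixmier set of `a`: the norm-closed convex hull of the unitary conjugates of `a`. -/
def dixmierSet (a : A) : Set A :=
  closure (convexHull ℝ {b : A | ∃ u : unitary A, b = (u : A) * a * star (u : A)})

/-- The real part `Re(wa) = (wa + (wa)*)/2`. -/
def realPart' (w : ℂ) (a : A) : A := (2 : ℂ)⁻¹ • (w • a + star (w • a))

/-- A functional is positive if it is nonnegative on all `x* x`. -/
def IsPos (f : WeakDual ℂ A) : Prop := ∀ x : A, 0 ≤ f (star x * x)

/-- `Dom k l`: the functional `k` is dominated by the functional `l` on positive elements. -/
def Dom (k l : WeakDual ℂ A) : Prop := ∀ x : A, ‖k (star x * x)‖ ≤ (l (star x * x)).re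

namespace WeakDual

@[simp] lemma add_apply' (k l : WeakDual ℂ A) (x : A) : (k + l) x = k x + l x := rfl
@[simp] lemma sub_apply' (k l : WeakDual ℂ A) (x : A) : (k - l) x = k x - l x := rfl
@[simp] lemma zero_apply' (x : A) : (0 : WeakDual ℂ A) x = 0 := rfl
@[simp] lemma real_smul_apply (t : ℝ) (k : WeakDual ℂ A) (x : A) : (t • k) x = t * k x := rfl
@[simp] lemma complex_smul_apply (t : ℂ) (k : WeakDual ℂ A) (x : A) : (t • k) x = t * k x := rfl

lemma map_real_smul (k : WeakDual ℂ A) (t : ℝ) (x : A) : k (t • x) = t * k x := by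
  rw [← Complex.coe_smul t x, map_smul, smul_eq_mul]

end WeakDual

/-- The conjugate functional `x ↦ f (a * x * b)`. -/
def sandwich (a b : A) (f : WeakDual ℂ A) : WeakDual ℂ A :=
  ContinuousLinearMap.comp (show A →L[ℂ] ℂ from f)
    ((ContinuousLinearMap.mul ℂ A a).comp ((ContinuousLinearMap.mul ℂ A).flip b))

@[simp] lemma sandwich_apply (a b : A) (f : WeakDual ℂ A) (x : A) :
    sandwich a b f x = f (a * x * b) := by
  change f (a * (x * b)) = _
  rw [mul_assoc]

lemma IsPos.dom_self {f : WeakDual ℂ A} (hf : IsPos f) : Dom f f := fun x => by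
  have := hf x
  rw [Complex.nonneg_iff] at this
  rw [← Complex.abs_re_eq_norm.2 this.2.symm, abs_of_nonneg this.1]

lemma Dom.norm_apply_star_mul_le_add {k l : WeakDual ℂ A} (h : Dom k l) (x y : A) :
    ‖k (star y * x)‖ ≤ (l (star x * x)).re + (l (star y * y)).re := by
  have e : (4 : ℂ) * k (star y * x) = k (star (x + y) * (x + y)) - k (star (x - y) * (x - y))
      + Complex.I * k (star (x + Complex.I • y) * (x + Complex.I • y))
      - Complex.I * k (star (x - Complex.I • y) * (x - Complex.I • y)) := by
    simp only [star_add, star_sub, star_smul, add_mul, mul_add, sub_mul, mul_sub, map_add, map_sub,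
      smul_mul_assoc, mul_smul_comm, map_smul, smul_eq_mul, Complex.star_def, Complex.conj_I]
    linear_combination (2 * k (star y * x) - 2 * k (star x * y)) * Complex.I_mul_I
  have e2 : (l (star (x + y) * (x + y))).re + (l (star (x - y) * (x - y))).re
      + (l (star (x + Complex.I • y) * (x + Complex.I • y))).re
      + (l (star (x - Complex.I • y) * (x - Complex.I • y))).re =
      4 * ((l (star x * x)).re + (l (star y * y)).re) := by
    simp only [star_add, star_sub, star_smul, add_mul, mul_add, sub_mul, mul_sub, map_add, map_sub,
      smul_mul_assoc, mul_smul_comm, map_smul, smul_eq_mul, Complex.star_def, Complex.conj_I]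
    simp
    ring
  have e3 : 4 * ‖k (star y * x)‖ = ‖(4 : ℂ) * k (star y * x)‖ := by simp
  have := h (x + y)
  have := h (x - y)
  have := h (x + Complex.I • y)
  have := h (x - Complex.I • y)
  have e4 : ‖(4 : ℂ) * k (star y * x)‖ ≤ ‖k (star (x + y) * (x + y))‖
      + ‖k (star (x - y) * (x - y))‖
      + ‖k (star (x + Complex.I • y) * (x + Complex.I • y))‖
      + ‖k (star (x - Complex.I • y) * (x - Complex.I • y))‖ := by
    rw [e]
    refine (norm_sub_le _ _).trans (add_le_add ((norm_add_le _ _).trans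
      (add_le_add (norm_sub_le _ _) ?_)) ?_) <;> simp
  linarith

lemma Dom.re_nonneg {k l : WeakDual ℂ A} (h : Dom k l) (x : A) : 0 ≤ (l (star x * x)).re :=
  (norm_nonneg _).trans (h x)

lemma Dom.norm_apply_star_mul_le {k l : WeakDual ℂ A} (h : Dom k l) (x y : A) :
    ‖k (star y * x)‖ ≤ 2 * √(l (star x * x)).re * √(l (star y * y)).re := by
  set p := (l (star x * x)).re with hp
  set q := (l (star y * y)).re with hq
  have hp0 : 0 ≤ p := h.re_nonneg x
  have hq0 : 0 ≤ q := h.re_nonneg y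
  have key : ∀ t : ℝ, 0 < t → ‖k (star y * x)‖ ≤ t ^ 2 * p + (t⁻¹) ^ 2 * q := by
    intro t ht
    have := h.norm_apply_star_mul_le_add (t • x) (t⁻¹ • y)
    simp only [star_smul, star_trivial, smul_mul_assoc, mul_smul_comm, smul_smul,
      WeakDual.map_real_smul] at this
    rw [mul_inv_cancel₀ ht.ne'] at this
    simp only [Complex.re_ofReal_mul, Complex.ofReal_one, one_mul] at this
    rw [← hp, ← hq] at this
    nlinarith
  have key2 : ∀ ε : ℝ, 0 < ε → ‖k (star y * x)‖ ≤ 2 * √(p + ε) * √(q + ε) := by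
    intro ε hε
    have hP : 0 < √(p + ε) := Real.sqrt_pos.2 (by linarith)
    have hQ : 0 < √(q + ε) := Real.sqrt_pos.2 (by linarith)
    have := key (√(√(q + ε) / √(p + ε))) (Real.sqrt_pos.2 (by positivity))
    rw [inv_pow, Real.sq_sqrt (by positivity)] at this
    refine this.trans ?_
    have h1 : √(q + ε) / √(p + ε) * p ≤ √(q + ε) * √(p + ε) := by
      rw [div_mul_eq_mul_div, div_le_iff₀ hP, mul_assoc, Real.mul_self_sqrt (by linarith)]
      gcongr; linarith
    have h2 : (√(q + ε) / √(p + ε))⁻¹ * q ≤ √(q + ε) * √(p + ε) := by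
      rw [inv_div, div_mul_eq_mul_div, div_le_iff₀ hQ, mul_right_comm,
        Real.mul_self_sqrt (by linarith), mul_comm]
      gcongr; linarith
    linarith
  have lim : Filter.Tendsto (fun ε : ℝ => 2 * √(p + ε) * √(q + ε)) (nhdsWithin 0 (Set.Ioi 0))
      (nhds (2 * √(p + 0) * √(q + 0))) := by
    apply (Continuous.tendsto _ _).mono_left nhdsWithin_le_nhds
    fun_prop
  rw [add_zero, add_zero] at lim
  refine ge_of_tendsto lim ?_
  filter_upwards [self_mem_nhdsWithin] with ε hε using key2 ε hε

/-- The `f`-seminorm `f (y y*)^{1/2}`. -/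
def sn (f : WeakDual ℂ A) (y : A) : ℝ := √(f (y * star y)).re

lemma sn_nonneg (f : WeakDual ℂ A) (y : A) : 0 ≤ sn f y := Real.sqrt_nonneg _

section order

variable [PartialOrder A] [StarOrderedRing A]

lemma IsPos.nonneg {f : WeakDual ℂ A} (hf : IsPos f) {x : A} (hx : 0 ≤ x) : 0 ≤ f x := by
  obtain ⟨b, rfl⟩ := CStarAlgebra.nonneg_iff_eq_star_mul_self.1 hx
  exact hf b

lemma isPos_iff {f : WeakDual ℂ A} : IsPos f ↔ ∀ x : A, 0 ≤ x → 0 ≤ f x :=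
  ⟨fun hf _ hx => hf.nonneg hx, fun h x => h _ (star_mul_self_nonneg x)⟩

lemma IsPos.re_nonneg {f : WeakDual ℂ A} (hf : IsPos f) {x : A} (hx : 0 ≤ x) : 0 ≤ (f x).re :=
  (Complex.nonneg_iff.1 (hf.nonneg hx)).1

lemma IsPos.mono {f : WeakDual ℂ A} (hf : IsPos f) {x y : A} (h : x ≤ y) :
    (f x).re ≤ (f y).re := by
  have := hf.re_nonneg (sub_nonneg.2 h)
  simpa using this

lemma IsPos.im_eq_zero {f : WeakDual ℂ A} (hf : IsPos f) {x : A} (hx : IsSelfAdjoint x) :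
    (f x).im = 0 := by
  have h1 : 0 ≤ algebraMap ℝ A ‖x‖ - x := sub_nonneg.2 hx.le_algebraMap_norm_self
  have h2 : (0 : A) ≤ algebraMap ℝ A ‖x‖ := by
    rw [Algebra.algebraMap_eq_smul_one]
    exact smul_nonneg (norm_nonneg _) zero_le_one
  have h3 := (Complex.nonneg_iff.1 (hf.nonneg h1)).2
  have h4 := (Complex.nonneg_iff.1 (hf.nonneg h2)).2
  rw [map_sub, Complex.sub_im] at h3
  linarith

lemma Dom.norm_le {k l : WeakDual ℂ A} (h : Dom k l) {x : A} (hx : 0 ≤ x) :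
    ‖k x‖ ≤ (l x).re := by
  obtain ⟨b, rfl⟩ := CStarAlgebra.nonneg_iff_eq_star_mul_self.1 hx
  exact h b

lemma dom_iff {k l : WeakDual ℂ A} : Dom k l ↔ ∀ x : A, 0 ≤ x → ‖k x‖ ≤ (l x).re :=
  ⟨fun hf _ hx => hf.norm_le hx, fun h x => h _ (star_mul_self_nonneg x)⟩

lemma IsPos.eq_re {f : WeakDual ℂ A} (hf : IsPos f) {x : A} (hx : IsSelfAdjoint x) :
    f x = ((f x).re : ℂ) := by
  apply Complex.ext <;> simp [hf.im_eq_zero hx]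

lemma IsPos.map_star {f : WeakDual ℂ A} (hf : IsPos f) (x : A) : f (star x) = star (f x) := by
  have h1 := hf.im_eq_zero (IsSelfAdjoint.add_star_self x)
  have h2 := hf.im_eq_zero (x := Complex.I • (x - star x)) (by
    rw [IsSelfAdjoint]; simp [star_smul, ← smul_neg])
  simp only [map_smul, map_add, map_sub, smul_eq_mul, Complex.add_im, Complex.sub_im,
    Complex.mul_im, Complex.I_re, Complex.I_im, zero_mul, one_mul, Complex.sub_re] at h1 h2
  apply Complex.ext <;> simp <;> linarith

lemma Dom.norm_apply_mul_mul_star_le {k l : WeakDual ℂ A} (h : Dom k l) (hl : IsPos l)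
    (y X z : A) : ‖k (y * X * star z)‖ ≤ 2 * ‖X‖ * sn l y * sn l z := by
  have h1 := h.norm_apply_star_mul_le (X * star z) (star y)
  rw [star_star, ← mul_assoc] at h1
  refine h1.trans ?_
  have h2 : star (X * star z) * (X * star z) ≤ (‖X‖ ^ 2 : ℝ) • (z * star z) := by
    have := CStarAlgebra.star_right_conjugate_le_norm_smul (a := z) (b := star X * X)
      (IsSelfAdjoint.star_mul_self X)
    rw [CStarRing.norm_star_mul_self, ← sq] at this
    simpa [mul_assoc] using this
  have h3 := hl.mono h2
  rw [WeakDual.map_real_smul, Complex.re_ofReal_mul] at h3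
  have h4 : √(l (star (X * star z) * (X * star z))).re ≤ ‖X‖ * sn l z := by
    refine (Real.sqrt_le_sqrt h3).trans ?_
    rw [Real.sqrt_mul (by positivity), Real.sqrt_sq (norm_nonneg _), sn]
  calc _ ≤ 2 * (‖X‖ * sn l z) * sn l y := by
        unfold sn at *
        gcongr
    _ = _ := by ring

lemma Dom.norm_apply_le {k l : WeakDual ℂ A} (h : Dom k l) (hl : IsPos l) (x : A) :
    ‖k x‖ ≤ 2 * (l 1).re * ‖x‖ := by
  have := h.norm_apply_mul_mul_star_le hl 1 x 1
  simp only [star_one, mul_one, one_mul, sn] at this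
  rwa [mul_assoc, Real.mul_self_sqrt, mul_right_comm] at this
  exact hl.re_nonneg zero_le_one

end order

/-- A cone with an order unit `v` such that `-v` is not in the cone has a positive functional
normalised at `v`. -/
lemma exists_linear_nonneg_of_orderUnit {E : Type*} [AddCommGroup E] [Module ℝ E]
    (C : PointedCone ℝ E) (v : E) (hv : ∀ x, ∃ t : ℝ, x + t • v ∈ C) (hC : -v ∉ C) :
    ∃ φ : E →ₗ[ℝ] ℝ, φ v = 1 ∧ ∀ x ∈ C, 0 ≤ φ x := by
  have hv0 : v ≠ 0 := by
    rintro rfl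
    exact hC (by simp)
  obtain ⟨g, hg1, hg2⟩ := riesz_extension C (LinearPMap.mkSpanSingleton v (1 : ℝ) hv0) (by
      rintro ⟨x, hx⟩ hxC
      obtain ⟨t, rfl⟩ := Submodule.mem_span_singleton.1 hx
      have e : LinearPMap.mkSpanSingleton v (1 : ℝ) hv0 ⟨t • v, hx⟩ = t := by
        have := LinearPMap.mkSpanSingleton'_apply v (1 : ℝ)
          (fun c hc => by simpa [hv0] using hc) t hx
        rw [smul_eq_mul, mul_one] at this
        exact this
      rw [e]
      by_contra! ht
      apply hC
      have := C.smul_mem (by simpa using ht.le : 0 ≤ (-t)⁻¹) hxC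
      convert this using 1
      change -v = (-t)⁻¹ • (t • v)
      rw [smul_smul, inv_neg, neg_mul, inv_mul_cancel₀ ht.ne, neg_one_smul]) (by
      intro y
      obtain ⟨t, ht⟩ := hv y
      exact ⟨⟨t • v, Submodule.mem_span_singleton.2 ⟨t, rfl⟩⟩, by simpa [add_comm] using ht⟩)
  refine ⟨g, ?_, hg2⟩
  have := hg1 ⟨v, Submodule.mem_span_singleton_self v⟩
  rw [this]
  exact LinearPMap.mkSpanSingleton_apply ℝ ℝ hv0 (1 : ℝ)

section order

variable [PartialOrder A] [StarOrderedRing A]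

/-- A real linear functional, positive on `A₊` and vanishing on skew elements, is the real part of
a positive functional on self-adjoint elements. -/
lemma exists_isPos_of_real (φ : A →ₗ[ℝ] ℝ) (h0 : ∀ x, 0 ≤ x → 0 ≤ φ x)
    (hs : ∀ x, star x = -x → φ x = 0) :
    ∃ f : WeakDual ℂ A, IsPos f ∧ ∀ x, (f x).re = φ x := by
  let g : A →ₗ[ℂ] ℂ := Module.Dual.extendRCLike (𝕜 := ℂ) φ
  have hre : ∀ x, (g x).re = φ x := fun x => by
    simp [g, Module.Dual.extendRCLike_apply]
  have him : ∀ x, IsSelfAdjoint x → (g x).im = 0 := fun x hx => by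
    have : φ (Complex.I • x) = 0 := hs _ (by simp [star_smul, hx.star_eq])
    simp [g, Module.Dual.extendRCLike_apply, this]
  have hpos : ∀ x, 0 ≤ x → 0 ≤ g x := fun x hx => by
    rw [Complex.nonneg_iff, hre, him x hx.isSelfAdjoint]
    exact ⟨h0 x hx, rfl⟩
  obtain ⟨C, hC⟩ := PositiveLinearMap.exists_norm_apply_le (PositiveLinearMap.mk₀ g hpos)
  have hC' : ∀ a, ‖g a‖ ≤ C * ‖a‖ := hC
  exact ⟨LinearMap.mkContinuous g C hC', isPos_iff.2 fun x hx => hpos x hx, fun x => hre x⟩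

/-- The real part of a functional is dominated, on positive elements, by a positive functional. -/
lemma exists_isPos_re_le (f : WeakDual ℂ A) :
    ∃ l : WeakDual ℂ A, IsPos l ∧ ∀ x, 0 ≤ x → (f x).re ≤ (l x).re := by
  set B : ℝ := ‖(show A →L[ℂ] ℂ from f)‖ * ‖(1 : A)‖ with hB
  have hfB : ∀ y : A, ∀ t : ℝ, 0 ≤ y → 0 ≤ t → y ≤ t • (1 : A) → (f y).re ≤ t * B := by
    intro y t hy ht hyt
    calc (f y).re ≤ ‖f y‖ := Complex.re_le_norm _
      _ ≤ ‖(show A →L[ℂ] ℂ from f)‖ * ‖y‖ :=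
        ContinuousLinearMap.le_opNorm (show A →L[ℂ] ℂ from f) y
      _ ≤ ‖(show A →L[ℂ] ℂ from f)‖ * (t * ‖(1 : A)‖) := by
        gcongr
        have := CStarAlgebra.norm_le_norm_of_nonneg_of_le hy hyt
        rwa [norm_smul, Real.norm_of_nonneg ht] at this
      _ = t * B := by rw [hB]; ring
  let C : PointedCone ℝ (A × ℝ) :=
    { carrier := {p | ∃ y : A, 0 ≤ y ∧ ∃ t : ℝ, 0 ≤ t ∧
        (2 : ℝ) • y ≤ p.1 + star p.1 + (2 * t) • 1 ∧ t * B - (f y).re ≤ p.2}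
      zero_mem' := ⟨0, le_rfl, 0, le_rfl, by simp, by simp⟩
      add_mem' := by
        rintro p q ⟨y, hy, t, ht, h1, h2⟩ ⟨y', hy', t', ht', h1', h2'⟩
        refine ⟨y + y', add_nonneg hy hy', t + t', add_nonneg ht ht', ?_, ?_⟩
        · convert add_le_add h1 h1' using 1
          · rw [smul_add]
          · simp only [Prod.fst_add, star_add, mul_add, add_smul]
            abel
        · simp only [map_add, Complex.add_re, Prod.snd_add]
          linarith
      smul_mem' := by
        rintro ⟨c, hc⟩ p ⟨y, hy, t, ht, h1, h2⟩
        refine ⟨c • y, smul_nonneg hc hy, c * t, mul_nonneg hc ht, ?_, ?_⟩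
        · convert smul_le_smul_of_nonneg_left h1 hc using 1
          · rw [smul_comm]
          · change c • p.1 + star (c • p.1) + _ = _
            simp only [star_smul, star_trivial, smul_add, smul_smul]
            ring_nf
        · change _ ≤ c * p.2
          rw [WeakDual.map_real_smul, Complex.re_ofReal_mul]
          nlinarith [mul_le_mul_of_nonneg_left h2 hc] }
  obtain ⟨φ, hφ1, hφ2⟩ := exists_linear_nonneg_of_orderUnit C ((0 : A), (1 : ℝ)) (by
      rintro ⟨x, r⟩
      have hsa : IsSelfAdjoint (-(x + star x)) := (IsSelfAdjoint.add_star_self x).neg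
      refine ⟨‖-(x + star x)‖ / 2 * B - r, 0, le_rfl, ‖-(x + star x)‖ / 2, by positivity, ?_, ?_⟩
      · have := hsa.le_algebraMap_norm_self
        rw [Algebra.algebraMap_eq_smul_one] at this
        simp only [smul_zero, Prod.fst_add, Prod.smul_fst, add_zero]
        rw [mul_div_cancel₀ _ two_ne_zero]
        have := add_le_add_right this (x + star x)
        simpa using this
      · simp) (by
      rintro ⟨y, hy, t, ht, h1, h2⟩
      have h3 : y ≤ t • (1 : A) := by
        have := smul_le_smul_of_nonneg_left h1 (by norm_num : (0 : ℝ) ≤ 1 / 2)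
        simpa [smul_smul] using this
      have := hfB y t hy ht h3
      simp only [Prod.snd_neg] at h2
      linarith)
  have hskew : ∀ x : A, star x = -x → (x, (0 : ℝ)) ∈ C := fun x hx =>
    ⟨0, le_rfl, 0, le_rfl, by simp [hx], by simp⟩
  obtain ⟨l, hl, hl'⟩ := exists_isPos_of_real (φ.comp (LinearMap.inl ℝ A ℝ)) (by
      intro x hx
      exact hφ2 _ ⟨0, le_rfl, 0, le_rfl, by
        simp [hx.isSelfAdjoint.star_eq, add_nonneg hx hx], by simp⟩) (by
      intro x hx
      apply le_antisymm
      · have := hφ2 _ (hskew (-x) (by simp [hx]))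
        have e : ((-x, (0 : ℝ)) : A × ℝ) = -(x, 0) := by simp
        rw [e, map_neg] at this
        simpa using this
      · exact hφ2 _ (hskew x hx))
  refine ⟨l, hl, fun x hx => ?_⟩
  rw [hl']
  have := hφ2 (x, -(f x).re) ⟨x, hx, 0, le_rfl, by
    simp [hx.isSelfAdjoint.star_eq, two_smul], by simp⟩
  have e : ((x, -(f x).re) : A × ℝ) = (x, 0) + (-(f x).re) • (0, 1) := by simp
  rw [e, map_add, map_smul, hφ1] at this
  change 0 ≤ φ (x, 0) + _ at this
  change _ ≤ φ (x, 0)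
  simp only [smul_eq_mul] at this
  linarith

/-- Every bounded functional is dominated by a positive functional. -/
lemma exists_dom (f : WeakDual ℂ A) : ∃ l : WeakDual ℂ A, IsPos l ∧ Dom f l := by
  obtain ⟨l1, h1, h1'⟩ := exists_isPos_re_le f
  obtain ⟨l2, h2, h2'⟩ := exists_isPos_re_le (-f)
  obtain ⟨l3, h3, h3'⟩ := exists_isPos_re_le (Complex.I • f)
  obtain ⟨l4, h4, h4'⟩ := exists_isPos_re_le (-(Complex.I • f))
  refine ⟨l1 + l2 + (l3 + l4), fun x => add_nonneg (add_nonneg (h1 x) (h2 x))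
    (add_nonneg (h3 x) (h4 x)), ?_⟩
  rw [dom_iff]
  intro x hx
  have e1 := h1' x hx
  have e2 : -(f x).re ≤ (l2 x).re := h2' x hx
  have e3 := h3' x hx
  have e4 : -(Complex.I * f x).re ≤ (l4 x).re := h4' x hx
  simp only [WeakDual.complex_smul_apply, Complex.mul_re, Complex.I_re, Complex.I_im, zero_mul,
    one_mul] at e3 e4
  have p1 := h1.re_nonneg hx
  have p2 := h2.re_nonneg hx
  have p3 := h3.re_nonneg hx
  have p4 := h4.re_nonneg hx
  refine (Complex.norm_le_abs_re_add_abs_im _).trans ?_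
  simp only [WeakDual.add_apply', Complex.add_re]
  apply add_le_add
  · rw [abs_le]; constructor <;> linarith
  · rw [abs_le]; constructor <;> linarith

/-- A unitary with real part a given self-adjoint contraction, together with the properties of its
imaginary part `c`. -/
lemma exists_unitary_of_selfAdjoint {b : A} (hb : IsSelfAdjoint b) (hb1 : ‖b‖ ≤ 1) :
    ∃ W : unitary A, (W : A) = b + Complex.I • CFC.sqrt (1 - b ^ 2) ∧
      star (W : A) = b - Complex.I • CFC.sqrt (1 - b ^ 2) := by
  refine ⟨⟨_, hb.self_add_I_smul_cfcSqrt_sub_sq_mem_unitary b hb1⟩, rfl, ?_⟩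
  simp [hb.star_eq, ← sub_eq_add_neg, (CFC.sqrt_nonneg (1 - b ^ 2 : A)).isSelfAdjoint.star_eq]

/-- An invertible contraction is a convex combination of unitaries. -/
lemma mem_convexHull_unitary_of_isUnit {y : A} (hy : IsUnit y) (hy1 : ‖y‖ ≤ 1) :
    y ∈ convexHull ℝ (unitary A : Set A) := by
  set p := CFC.abs y with hp
  have hpsa : IsSelfAdjoint p := (CFC.abs_nonneg y).isSelfAdjoint
  have hpp : p * p = star y * y := CFC.abs_mul_abs y
  have hpu : IsUnit p := by
    have : IsUnit (p * p) := hpp ▸ (hy.star.mul hy)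
    exact ((Commute.refl p).isUnit_mul_iff.1 this).1
  obtain ⟨q, hq⟩ := hpu
  have hqp : (↑q⁻¹ : A) * p = 1 := by rw [← hq]; exact q.inv_mul
  have hpq : p * (↑q⁻¹ : A) = 1 := by rw [← hq]; exact q.mul_inv
  have hqs : star (↑q⁻¹ : A) = ↑q⁻¹ := by
    have h := congrArg star hpq
    rw [star_mul, hpsa.star_eq, star_one] at h
    calc star (↑q⁻¹ : A) = star (↑q⁻¹ : A) * (p * ↑q⁻¹) := by rw [hpq, mul_one]
      _ = ↑q⁻¹ := by rw [← mul_assoc, h, one_mul]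
  set v : A := y * ↑q⁻¹ with hv
  have hvv : star v * v = 1 := by
    rw [hv, star_mul, hqs]
    calc (↑q⁻¹ : A) * star y * (y * ↑q⁻¹) = ↑q⁻¹ * (star y * y) * ↑q⁻¹ := by
          simp only [mul_assoc]
      _ = (↑q⁻¹ * p) * (p * ↑q⁻¹) := by rw [← hpp]; simp only [mul_assoc]
      _ = 1 := by rw [hqp, hpq, one_mul]
  have hvu : IsUnit v := hy.mul q⁻¹.isUnit
  have hvv' : v * star v = 1 := by
    obtain ⟨V, hV⟩ := hvu
    have h1 : star v = (↑V⁻¹ : A) := by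
      rw [← hV] at hvv ⊢
      exact V.eq_inv_of_mul_eq_one_right hvv
    rw [h1, ← hV]
    exact V.mul_inv
  have hvU : v ∈ unitary A := Unitary.mem_iff.2 ⟨hvv, hvv'⟩
  obtain ⟨W, hW, hW'⟩ := exists_unitary_of_selfAdjoint hpsa
    (by rw [hp, CFC.norm_abs]; exact hy1)
  have hyv : y = (1 / 2 : ℝ) • (v * (W : A)) + (1 / 2 : ℝ) • (v * star (W : A)) := by
    rw [← smul_add, ← mul_add, hW', hW, add_add_sub_cancel, ← two_smul ℝ, mul_smul_comm, smul_smul,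
      hv, mul_assoc, hqp]
    norm_num
  rw [hyv]
  have h1 : v * (W : A) ∈ unitary A := mul_mem hvU W.2
  have h2 : v * star (W : A) ∈ unitary A := mul_mem hvU (star W).2
  exact (convex_convexHull ℝ _) (subset_convexHull ℝ _ h1) (subset_convexHull ℝ _ h2)
    (by norm_num) (by norm_num) (by norm_num)

/-- **Russo–Dye theorem**: the unit ball is the closed convex hull of the unitaries. -/
lemma mem_closure_convexHull_unitary {w : A} (hw : ‖w‖ ≤ 1) :
    w ∈ closure (convexHull ℝ (unitary A : Set A)) := by
  rcases subsingleton_or_nontrivial A with hA | hA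
  · rw [Subsingleton.elim w 1]
    exact subset_closure (subset_convexHull ℝ _ (one_mem (unitary A)))
  have main : ∀ w : A, ‖w‖ < 1 → w ∈ closure (convexHull ℝ (unitary A : Set A)) := by
    intro w hw
    set S := convexHull ℝ (unitary A : Set A) with hS
    have step1 : ∀ u ∈ (unitary A : Set A), (1 / 2 : ℝ) • (u + w) ∈ S := by
      intro u hu
      apply mem_convexHull_unitary_of_isUnit
      · have h1 : u + w = u * (1 - -(star u * w)) := by
          rw [sub_neg_eq_add, mul_add, mul_one, ← mul_assoc, (Unitary.mem_iff.1 hu).2, one_mul]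
        have h2 : IsUnit (1 - -(star u * w)) := by
          apply isUnit_one_sub_of_norm_lt_one
          rw [norm_neg]
          calc ‖star u * w‖ ≤ ‖star u‖ * ‖w‖ := norm_mul_le _ _
            _ = ‖w‖ := by rw [norm_star, CStarRing.norm_of_mem_unitary hu, one_mul]
            _ < 1 := hw
        rw [h1]
        have h3 : IsUnit u := (Unitary.toUnits ⟨u, hu⟩).isUnit
        have h4 := h3.mul h2
        exact (isUnit_smul_iff (Units.mk0 (1 / 2 : ℝ) (by norm_num)) _).2 h4
      · rw [norm_smul]
        have : ‖u + w‖ ≤ 1 + 1 := (norm_add_le _ _).trans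
          (add_le_add (CStarRing.norm_of_mem_unitary hu).le hw.le)
        norm_num
        linarith
    have step2 : ∀ s ∈ S, (1 / 2 : ℝ) • (s + w) ∈ S := by
      intro s hs
      have hc : Convex ℝ {s : A | (1 / 2 : ℝ) • (s + w) ∈ S} := by
        intro x hx y hy a b ha hb hab
        have := (convex_convexHull ℝ _) hx hy ha hb hab
        change (1 / 2 : ℝ) • (a • x + b • y + w) ∈ S
        convert this using 1
        have : w = a • w + b • w := by rw [← add_smul, hab, one_smul]
        nth_rewrite 1 [this]
        module
      exact convexHull_min step1 hc hs
    have step3 : ∀ n : ℕ, w + ((1 / 2 : ℝ) ^ n) • (1 - w) ∈ S := by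
      intro n
      induction n with
      | zero =>
        simp only [pow_zero, one_smul, add_sub_cancel]
        exact subset_convexHull ℝ _ (one_mem (unitary A))
      | succ n ih =>
        have := step2 _ ih
        convert this using 1
        rw [pow_succ]
        module
    refine mem_closure_of_tendsto (f := fun n : ℕ => w + ((1 / 2 : ℝ) ^ n) • (1 - w)) ?_
      (Filter.Eventually.of_forall step3) (b := Filter.atTop)
    have := (tendsto_pow_atTop_nhds_zero_of_lt_one (r := (1 / 2 : ℝ)) (by norm_num)
      (by norm_num)).smul_const (1 - w) |>.const_add w
    simpa using this
  refine isClosed_closure.mem_of_tendsto (f := fun n : ℕ => (1 - (1 / 2 : ℝ) ^ n) • w) ?_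
    (b := Filter.atTop) ?_
  · have := ((tendsto_pow_atTop_nhds_zero_of_lt_one (r := (1 / 2 : ℝ)) (by norm_num)
      (by norm_num)).const_sub 1).smul_const w
    simpa using this
  · refine Filter.Eventually.of_forall fun n => main _ ?_
    have h0 : (0 : ℝ) < (1 / 2) ^ n := by positivity
    have h1 : (1 / 2 : ℝ) ^ n ≤ 1 := pow_le_one₀ (by norm_num) (by norm_num)
    rw [norm_smul, Real.norm_of_nonneg (by linarith)]
    nlinarith [norm_nonneg w]

/-- A lower bound for `Re k(u a u*)` on unitaries extends to contractions with a defect term. -/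
lemma Dom.le_of_contraction {k l : WeakDual ℂ A} (h : Dom k l) (hl : IsPos l) {a : A} {r : ℝ}
    (hr : ∀ u : unitary A, r ≤ (k ((u : A) * a * star (u : A))).re) {w : A} (hw : ‖w‖ ≤ 1) :
    r ≤ (k (w * a * star w)).re + 2 * ‖a‖ * ((l 1).re - (l (w * star w)).re) := by
  set G : A → ℝ := fun w => (k (w * a * star w)).re - 2 * ‖a‖ * (l (w * star w)).re with hG
  have hG0 : ∀ y, G y ≤ 0 := by
    intro y
    have h1 := h.norm_apply_mul_mul_star_le hl y a y
    have h2 : sn l y * sn l y = (l (y * star y)).re :=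
      Real.mul_self_sqrt (hl.re_nonneg (mul_star_self_nonneg y))
    rw [mul_assoc (2 * ‖a‖), h2] at h1
    have := (Complex.re_le_norm (k (y * a * star y))).trans h1
    simp only [hG]
    linarith
  have hGc : Continuous G := by
    have hk : Continuous fun x : A => k x := ContinuousLinearMap.continuous (show A →L[ℂ] ℂ from k)
    have hl : Continuous fun x : A => l x := ContinuousLinearMap.continuous (show A →L[ℂ] ℂ from l)
    exact (Complex.continuous_re.comp (hk.comp (by fun_prop))).sub
      (continuous_const.mul (Complex.continuous_re.comp (hl.comp (by fun_prop))))
  have hGq : ∀ x y : A, ∀ s t : ℝ, s + t = 1 →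
      G (s • x + t • y) = s * G x + t * G y - s * t * G (x - y) := by
    intro x y s t hst
    obtain rfl : t = 1 - s := by linarith
    simp only [hG, star_add, star_sub, star_smul, star_trivial, add_mul, mul_add, sub_mul, mul_sub,
      smul_mul_assoc, mul_smul_comm, map_add, map_sub, WeakDual.map_real_smul, Complex.add_re,
      Complex.sub_re, Complex.re_ofReal_mul]
    ring
  have hcl : IsClosed {w | r - 2 * ‖a‖ * (l 1).re ≤ G w} := isClosed_le continuous_const hGc
  have hcv : Convex ℝ {w | r - 2 * ‖a‖ * (l 1).re ≤ G w} := by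
    intro x hx y hy s t hs ht hst
    simp only [Set.mem_ofPred_eq] at hx hy ⊢
    rw [hGq x y s t hst]
    have : s * t * G (x - y) ≤ 0 := mul_nonpos_of_nonneg_of_nonpos (mul_nonneg hs ht) (hG0 _)
    have h1 := mul_le_mul_of_nonneg_left hx hs
    have h2 := mul_le_mul_of_nonneg_left hy ht
    have h3 : (s + t) * (r - 2 * ‖a‖ * (l 1).re) = r - 2 * ‖a‖ * (l 1).re := by rw [hst, one_mul]
    linarith
  have hU : (unitary A : Set A) ⊆ {w | r - 2 * ‖a‖ * (l 1).re ≤ G w} := by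
    intro u hu
    have := hr ⟨u, hu⟩
    simp only [hG, Set.mem_ofPred_eq, (Unitary.mem_iff.1 hu).2]
    linarith
  have := closure_minimal (convexHull_min hU hcv) hcl (mem_closure_convexHull_unitary hw)
  simp only [hG, Set.mem_ofPred_eq] at this
  linarith

end order

/-- The pairs `(k, l)` with `l` a state dominating `k`. -/
def domPairs (A : Type u) [CStarAlgebra A] : Set (WeakDual ℂ A × WeakDual ℂ A) :=
  {p | IsPos p.2 ∧ p.2 1 = 1 ∧ Dom p.1 p.2}

/-- Conjugation of a functional by a unitary. -/
def adj (u : unitary A) (f : WeakDual ℂ A) : WeakDual ℂ A := sandwich (u : A) (star (u : A)) f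

@[simp] lemma adj_apply (u : unitary A) (f : WeakDual ℂ A) (x : A) :
    adj u f x = f ((u : A) * x * star (u : A)) := sandwich_apply _ _ _ _

lemma isCompact_setOf_norm_le (C : ℝ) : IsCompact {f : WeakDual ℂ A | ∀ x, ‖f x‖ ≤ C * ‖x‖} := by
  refine (WeakDual.isCompact_closedBall (𝕜 := ℂ) (0 : StrongDual ℂ A) |C|).of_isClosed_subset ?_ ?_
  · rw [Set.ofPred_forall]
    exact isClosed_iInter fun x =>
      isClosed_le (WeakDual.eval_continuous x).norm continuous_const
  · intro f hf
    simp only [Set.mem_preimage, Metric.mem_closedBall, dist_zero_right]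
    exact ContinuousLinearMap.opNorm_le_bound _ (abs_nonneg C) fun x =>
      (hf x).trans (mul_le_mul_of_nonneg_right (le_abs_self C) (norm_nonneg x))

lemma isClosed_isPos : IsClosed {f : WeakDual ℂ A | IsPos f} := by
  simp only [IsPos]
  rw [Set.ofPred_forall]
  exact isClosed_iInter fun x => isClosed_le continuous_const (WeakDual.eval_continuous _)

lemma convex_domPairs : Convex ℝ (domPairs A) := by
  rintro ⟨k, l⟩ ⟨h1, h2, h3⟩ ⟨k', l'⟩ ⟨h1', h2', h3'⟩ s t hs ht hst
  simp only at h1 h2 h3 h1' h2' h3'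
  refine ⟨fun x => ?_, ?_, fun x => ?_⟩
  · change 0 ≤ (s : ℂ) * l _ + (t : ℂ) * l' _
    exact add_nonneg (mul_nonneg (by exact_mod_cast hs) (h1 x))
      (mul_nonneg (by exact_mod_cast ht) (h1' x))
  · change (s : ℂ) * l 1 + (t : ℂ) * l' 1 = 1
    rw [h2, h2', mul_one, mul_one]
    exact_mod_cast hst
  · change ‖(s : ℂ) * k _ + (t : ℂ) * k' _‖ ≤ ((s : ℂ) * l _ + (t : ℂ) * l' _).re
    rw [Complex.add_re, Complex.re_ofReal_mul, Complex.re_ofReal_mul]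
    refine (norm_add_le _ _).trans ?_
    rw [norm_mul, norm_mul, Complex.norm_of_nonneg hs, Complex.norm_of_nonneg ht]
    have := h3 x
    have := h3' x
    gcongr

section order

variable [PartialOrder A] [StarOrderedRing A]

lemma IsPos.adj {f : WeakDual ℂ A} (hf : IsPos f) (u : unitary A) : IsPos (adj u f) := by
  rw [isPos_iff]
  intro x hx
  rw [adj_apply]
  exact hf.nonneg (star_right_conjugate_nonneg hx _)

lemma Dom.adj {k l : WeakDual ℂ A} (h : Dom k l) (u : unitary A) :
    Dom (adj u k) (adj u l) := by
  rw [dom_iff]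
  intro x hx
  rw [adj_apply, adj_apply]
  exact h.norm_le (star_right_conjugate_nonneg hx _)

lemma isCompact_domPairs : IsCompact (domPairs A) := by
  refine ((isCompact_setOf_norm_le 2).prod (isCompact_setOf_norm_le 2)).of_isClosed_subset ?_ ?_
  · refine (isClosed_isPos.preimage continuous_snd).inter (IsClosed.inter
      (isClosed_eq ((WeakDual.eval_continuous _).comp continuous_snd) continuous_const) ?_)
    change IsClosed {p : WeakDual ℂ A × WeakDual ℂ A | ∀ x, _}
    rw [Set.ofPred_forall]
    exact isClosed_iInter fun x => isClosed_le
      ((WeakDual.eval_continuous _).comp continuous_fst).norm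
      (Complex.continuous_re.comp ((WeakDual.eval_continuous _).comp continuous_snd))
  · rintro ⟨k, l⟩ ⟨h1, h2, h3⟩
    change l 1 = 1 at h2
    refine ⟨fun x => ?_, fun x => ?_⟩
    · simpa [h2] using h3.norm_apply_le h1 x
    · simpa [h2] using h1.dom_self.norm_apply_le h1 x

lemma adj_mem_domPairs {p : WeakDual ℂ A × WeakDual ℂ A} (hp : p ∈ domPairs A) (u : unitary A) :
    (adj u p.1, adj u p.2) ∈ domPairs A := by
  obtain ⟨h1, h2, h3⟩ := hp
  refine ⟨h1.adj u, ?_, h3.adj u⟩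
  simp [h2]

/-- Separation of `0` from the Dixmier set by a functional dominated by a state. -/
lemma exists_domPair_of_zero_notMem {a : A} (h : (0 : A) ∉ dixmierSet a) :
    ∃ p ∈ domPairs A, ∃ r : ℝ, 0 < r ∧ ∀ u : unitary A,
      r ≤ (p.1 ((u : A) * a * star (u : A))).re := by
  obtain ⟨f, r, h1, h2⟩ := RCLike.geometric_hahn_banach_point_closed (𝕜 := ℂ)
    (convex_convexHull ℝ _).closure isClosed_closure h
  simp only [map_zero] at h1
  have hr : ∀ u : unitary A, r ≤ (f ((u : A) * a * star (u : A))).re := fun u =>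
    (h2 _ (subset_closure (subset_convexHull ℝ _ ⟨u, rfl⟩))).le
  obtain ⟨l, hl, hd⟩ := exists_dom (show WeakDual ℂ A from f)
  have hl1 : 0 < (l 1).re := by
    refine lt_of_le_of_ne (hl.re_nonneg zero_le_one) fun h0 => ?_
    have := hd.norm_apply_le hl a
    rw [← h0] at this
    have h3 := hr 1
    have h4 := Complex.re_le_norm (f a)
    simp only [OneMemClass.coe_one, one_mul, star_one, mul_one] at h3
    simp only [mul_zero, zero_mul] at this
    change ‖f a‖ ≤ 0 at this
    have h1' : 0 < r := h1
    linarith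
  have hl1' : l 1 = ((l 1).re : ℂ) := hl.eq_re (.one _)
  set t : ℝ := ((l 1).re)⁻¹ with ht
  have ht0 : 0 < t := inv_pos.2 hl1
  refine ⟨(t • (show WeakDual ℂ A from f), t • l), ⟨fun x => ?_, ?_, fun x => ?_⟩, t * r,
    mul_pos ht0 h1, fun u => ?_⟩
  · exact mul_nonneg (Complex.zero_le_real.2 ht0.le) (hl x)
  · change (t : ℂ) * l 1 = 1
    rw [hl1', ← Complex.ofReal_mul, ht, inv_mul_cancel₀ hl1.ne', Complex.ofReal_one]
  · change ‖(t : ℂ) * f _‖ ≤ ((t : ℂ) * l _).re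
    rw [Complex.re_ofReal_mul, norm_mul, Complex.norm_of_nonneg ht0.le]
    exact mul_le_mul_of_nonneg_left (hd x) ht0.le
  · change t * r ≤ ((t : ℂ) * f _).re
    rw [Complex.re_ofReal_mul]
    exact mul_le_mul_of_nonneg_left (hr u) ht0.le

/-- The minimal convex invariant set of extremal separating pairs. -/
lemma exists_extremal_pairs {a : A} (h : (0 : A) ∉ dixmierSet a) :
    ∃ (r : ℝ) (z : ℂ) (X : Set (WeakDual ℂ A × WeakDual ℂ A)), 0 < r ∧
      (∀ p ∈ domPairs A, ∀ r' : ℝ, (∀ u : unitary A, r' ≤ (p.1 ((u : A) * a * star (u : A))).re) →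
        r' ≤ r) ∧
      (∀ p ∈ domPairs A, (∀ u : unitary A, r ≤ (p.1 ((u : A) * a * star (u : A))).re) →
        ‖p.1 1‖ ≤ ‖z‖) ∧
      X ⊆ domPairs A ∧
      (∀ p ∈ X, p.1 1 = z ∧ ∀ u : unitary A, r ≤ (p.1 ((u : A) * a * star (u : A))).re) ∧
      X.Nonempty ∧ Convex ℝ X ∧ (∀ p ∈ X, ∀ u : unitary A, (adj u p.1, adj u p.2) ∈ X) ∧
      (∀ (c : ℂ) (s t : ℝ), ∀ p ∈ X,
        (∀ e ∈ Set.Icc (0 : A) 1, (c * p.1 e).re - s * (p.2 e).re ≤ t) →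
        ∀ q ∈ X, ∀ e ∈ Set.Icc (0 : A) 1, (c * q.1 e).re - s * (q.2 e).re ≤ t) := by
  obtain ⟨p₀, hp₀, r₀, hr₀, hpr₀⟩ := exists_domPair_of_zero_notMem h
  have cont1 : ∀ x : A, Continuous fun p : WeakDual ℂ A × WeakDual ℂ A => p.1 x := fun x =>
    (WeakDual.eval_continuous x).comp continuous_fst
  have cont2 : ∀ x : A, Continuous fun p : WeakDual ℂ A × WeakDual ℂ A => p.2 x := fun x =>
    (WeakDual.eval_continuous x).comp continuous_snd
  have hcl : IsClosed {q : (WeakDual ℂ A × WeakDual ℂ A) × ℝ |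
      ∀ u : unitary A, q.2 ≤ (q.1.1 ((u : A) * a * star (u : A))).re} := by
    rw [Set.ofPred_forall]
    exact isClosed_iInter fun u => isClosed_le continuous_snd
      (Complex.continuous_re.comp ((cont1 _).comp continuous_fst))
  have hK := (isCompact_domPairs (A := A)).prod (isCompact_Icc (a := (0 : ℝ)) (b := 2 * ‖a‖))
  have hbd : ∀ p ∈ domPairs A, ∀ r' : ℝ,
      (∀ u : unitary A, r' ≤ (p.1 ((u : A) * a * star (u : A))).re) → r' ≤ 2 * ‖a‖ := by
    rintro ⟨k, l⟩ ⟨h1, h2, h3⟩ r' hr'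
    have := hr' 1
    simp only [OneMemClass.coe_one, one_mul, star_one, mul_one] at this h1 h2 h3
    have h4 := h3.norm_apply_le h1 a
    rw [h2, Complex.one_re, mul_one] at h4
    exact this.trans ((Complex.re_le_norm _).trans h4)
  obtain ⟨⟨p₁, r⟩, ⟨⟨hp₁, hr1⟩, hpr₁⟩, hmax⟩ := (hK.inter_right hcl).exists_isMaxOn
    ⟨(p₀, r₀), ⟨hp₀, hr₀.le, hbd _ hp₀ _ hpr₀⟩, hpr₀⟩ continuous_snd.continuousOn
  have hrpos : 0 < r := hr₀.trans_le
    (hmax (show (p₀, r₀) ∈ _ from ⟨⟨hp₀, hr₀.le, hbd _ hp₀ _ hpr₀⟩, hpr₀⟩))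
  have hrmax : ∀ p ∈ domPairs A, ∀ r' : ℝ,
      (∀ u : unitary A, r' ≤ (p.1 ((u : A) * a * star (u : A))).re) → r' ≤ r := by
    intro p hp r' hr'
    rcases le_total r' 0 with h0 | h0
    · exact h0.trans hrpos.le
    · exact hmax (show (p, r') ∈ _ from ⟨⟨hp, h0, hbd _ hp _ hr'⟩, hr'⟩)
  set M : Set (WeakDual ℂ A × WeakDual ℂ A) :=
    domPairs A ∩ {p | ∀ u : unitary A, r ≤ (p.1 ((u : A) * a * star (u : A))).re} with hM
  have hMcl : IsClosed {p : WeakDual ℂ A × WeakDual ℂ A |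
      ∀ u : unitary A, r ≤ (p.1 ((u : A) * a * star (u : A))).re} := by
    rw [Set.ofPred_forall]
    exact isClosed_iInter fun u => isClosed_le continuous_const
      (Complex.continuous_re.comp (cont1 _))
  have hMc : IsCompact M := isCompact_domPairs.inter_right hMcl
  obtain ⟨p₂, hp₂, hmax₂⟩ := hMc.exists_isMaxOn ⟨p₁, hp₁, hpr₁⟩ (cont1 1).norm.continuousOn
  set z := p₂.1 1 with hz
  set Mz := M ∩ {p | p.1 1 = z} with hMz
  have hMzc : IsCompact Mz := hMc.inter_right (isClosed_eq (cont1 1) continuous_const)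
  have hMzconv : Convex ℝ Mz := by
    refine (convex_domPairs.inter ?_).inter ?_
    · intro p hp q hq s t hs ht hst u
      change r ≤ ((s : ℂ) * p.1 _ + (t : ℂ) * q.1 _).re
      rw [Complex.add_re, Complex.re_ofReal_mul, Complex.re_ofReal_mul]
      have h1 := mul_le_mul_of_nonneg_left (hp u) hs
      have h2 := mul_le_mul_of_nonneg_left (hq u) ht
      have h3 : (s + t) * r = r := by rw [hst, one_mul]
      linarith
    · intro p hp q hq s t hs ht hst
      change (s : ℂ) * p.1 _ + (t : ℂ) * q.1 _ = z
      have hp' : p.1 1 = z := hp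
      have hq' : q.1 1 = z := hq
      rw [hp', hq', ← add_mul, ← Complex.ofReal_add, hst, Complex.ofReal_one, one_mul]
  have hMzadj : ∀ p ∈ Mz, ∀ u : unitary A, (adj u p.1, adj u p.2) ∈ Mz := by
    rintro p ⟨⟨h1, h2⟩, h3⟩ u
    refine ⟨⟨adj_mem_domPairs h1 u, fun v => ?_⟩, ?_⟩
    · have := h2 (u * v)
      simp only [adj_apply]
      simpa [mul_assoc] using this
    · have : p.1 1 = z := h3
      change adj u p.1 1 = z
      simpa using this
  let S : Set (Set (WeakDual ℂ A × WeakDual ℂ A)) := {X | X ⊆ Mz ∧ IsClosed X ∧ X.Nonempty ∧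
    Convex ℝ X ∧ ∀ p ∈ X, ∀ u : unitary A, (adj u p.1, adj u p.2) ∈ X}
  have hMzS : Mz ∈ S := ⟨subset_rfl, hMzc.isClosed, ⟨p₂, hp₂, rfl⟩, hMzconv, hMzadj⟩
  obtain ⟨X, -, hXmin⟩ := zorn_superset_nonempty S (by
    intro c hc hchain hne
    refine ⟨⋂₀ c, ⟨?_, ?_, ?_, ?_, ?_⟩, fun s hs => Set.sInter_subset_of_mem hs⟩
    · obtain ⟨s, hs⟩ := hne
      exact (Set.sInter_subset_of_mem hs).trans (hc hs).1
    · exact isClosed_sInter fun s hs => (hc hs).2.1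
    · exact IsCompact.nonempty_sInter_of_directed_nonempty_isCompact_isClosed (hS := hne.to_subtype)
        (fun x hx y hy => (hchain.total hx hy).elim (fun h => ⟨x, hx, subset_rfl, h⟩)
          (fun h => ⟨y, hy, h, subset_rfl⟩)) (fun s hs => (hc hs).2.2.1)
        (fun s hs => hMzc.of_isClosed_subset (hc hs).2.1 (hc hs).1) (fun s hs => (hc hs).2.1)
    · exact convex_sInter fun s hs => (hc hs).2.2.2.1
    · intro p hp u s hs
      exact (hc hs).2.2.2.2 p (hp s hs) u) Mz hMzS
  obtain ⟨hX1, hX2, hX3, hX4, hX5⟩ := hXmin.prop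
  refine ⟨r, z, X, hrpos, hrmax, fun p hp hpr => hmax₂ ⟨hp, hpr⟩, fun p hp => (hX1 hp).1.1,
    fun p hp => ⟨(hX1 hp).2, (hX1 hp).1.2⟩, hX3, hX4, hX5, ?_⟩
  intro c s t p hp hpt q hq
  set X' := X ∩ {p | ∀ e ∈ Set.Icc (0 : A) 1, (c * p.1 e).re - s * (p.2 e).re ≤ t} with hX'
  have hX'S : X' ∈ S := by
    refine ⟨Set.inter_subset_left.trans hX1, hX2.inter ?_, ⟨p, hp, hpt⟩, hX4.inter ?_, ?_⟩
    · have : {p : WeakDual ℂ A × WeakDual ℂ A |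
          ∀ e ∈ Set.Icc (0 : A) 1, (c * p.1 e).re - s * (p.2 e).re ≤ t} =
          ⋂ e ∈ Set.Icc (0 : A) 1, {p | (c * p.1 e).re - s * (p.2 e).re ≤ t} := by
        ext; simp
      rw [this]
      exact isClosed_biInter fun e _ => isClosed_le
        ((Complex.continuous_re.comp (continuous_const.mul (cont1 e))).sub
          (continuous_const.mul (Complex.continuous_re.comp (cont2 e)))) continuous_const
    · intro p hp q hq x y hx hy hxy e he
      change (c * ((x : ℂ) * p.1 e + (y : ℂ) * q.1 e)).re
        - s * ((x : ℂ) * p.2 e + (y : ℂ) * q.2 e).re ≤ t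
      have h1 := mul_le_mul_of_nonneg_left (hp e he) hx
      have h2 := mul_le_mul_of_nonneg_left (hq e he) hy
      have h3 : (x + y) * t = t := by rw [hxy, one_mul]
      rw [mul_add, mul_left_comm, mul_left_comm c, Complex.add_re, Complex.add_re,
        Complex.re_ofReal_mul, Complex.re_ofReal_mul, Complex.re_ofReal_mul, Complex.re_ofReal_mul]
      linarith
    · rintro p ⟨hp, hpt⟩ u
      refine ⟨hX5 p hp u, fun e he => ?_⟩
      have := hpt ((u : A) * e * star (u : A)) ⟨star_right_conjugate_nonneg he.1 _, by
        have := star_right_conjugate_le_conjugate he.2 (u : A)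
        simpa using this⟩
      simpa using this
  exact (hXmin.le_of_le hX'S Set.inter_subset_left hq).2

end order

open Filter Topology

/-- The functional `Re (c k) - s Re l`. -/
def tilt (k l : WeakDual ℂ A) (c : ℂ) (s : ℝ) (x : A) : ℝ := (c * k x).re - s * (l x).re

lemma tilt_add (k l : WeakDual ℂ A) (c : ℂ) (s : ℝ) (x y : A) :
    tilt k l c s (x + y) = tilt k l c s x + tilt k l c s y := by
  simp only [tilt, map_add, mul_add, Complex.add_re]; ring

lemma tilt_sub (k l : WeakDual ℂ A) (c : ℂ) (s : ℝ) (x y : A) :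
    tilt k l c s (x - y) = tilt k l c s x - tilt k l c s y := by
  simp only [tilt, map_sub, mul_sub, Complex.sub_re]; ring

lemma tilt_smul (k l : WeakDual ℂ A) (c : ℂ) (s t : ℝ) (x : A) :
    tilt k l c s (t • x) = t * tilt k l c s x := by
  simp only [tilt, WeakDual.map_real_smul, mul_left_comm c, Complex.re_ofReal_mul]; ring

section order

variable [PartialOrder A] [StarOrderedRing A]

lemma conj_mem_Icc {e : A} (he : e ∈ Set.Icc (0 : A) 1) (u : unitary A) :
    (u : A) * e * star (u : A) ∈ Set.Icc (0 : A) 1 := by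
  refine ⟨star_right_conjugate_nonneg he.1 _, ?_⟩
  have := star_right_conjugate_le_conjugate he.2 (u : A)
  simpa using this

lemma sub_mul_self_nonneg {e : A} (he : e ∈ Set.Icc (0 : A) 1) : 0 ≤ e - e * e := by
  have h : Commute e (1 - e) := (Commute.one_right e).sub_right (Commute.refl e)
  have := h.mul_nonneg he.1 (sub_nonneg.2 he.2)
  rwa [mul_sub, mul_one] at this

lemma mul_self_mem_Icc {e : A} (he : e ∈ Set.Icc (0 : A) 1) : e * e ∈ Set.Icc (0 : A) 1 :=
  ⟨by simpa [he.1.isSelfAdjoint.star_eq] using star_mul_self_nonneg e,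
    (sub_nonneg.1 (sub_mul_self_nonneg he)).trans he.2⟩

lemma two_sub_mul_self_mem_Icc {e : A} (he : e ∈ Set.Icc (0 : A) 1) :
    (e + e) - e * e ∈ Set.Icc (0 : A) 1 := by
  constructor
  · rw [add_sub_assoc]
    exact add_nonneg he.1 (sub_mul_self_nonneg he)
  · have h1 : 0 ≤ (1 - e) * (1 - e) := by
      have : star (1 - e) = 1 - e := by rw [star_sub, star_one, he.1.isSelfAdjoint.star_eq]
      simpa [this] using star_mul_self_nonneg (1 - e)
    rw [← sub_nonneg]
    convert h1 using 1
    noncomm_ring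

/-- The optimal value of `tilt` on `[0,1]`. -/
def optVal (k l : WeakDual ℂ A) (c : ℂ) (s : ℝ) : ℝ :=
  sSup (tilt k l c s '' Set.Icc (0 : A) 1)

variable {k l : WeakDual ℂ A}

lemma IsPos.re_mem_Icc (hl : IsPos l) (hl1 : l 1 = 1) {e : A} (he : e ∈ Set.Icc (0 : A) 1) :
    (l e).re ∈ Set.Icc (0 : ℝ) 1 :=
  ⟨hl.re_nonneg he.1, by simpa [hl1] using hl.mono he.2⟩

lemma bddAbove_tilt (hl : IsPos l) (hl1 : l 1 = 1) (h : Dom k l) (c : ℂ) (s : ℝ) :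
    BddAbove (tilt k l c s '' Set.Icc (0 : A) 1) := by
  refine ⟨‖c‖ + |s|, ?_⟩
  rintro _ ⟨e, he, rfl⟩
  have h1 := hl.re_mem_Icc hl1 he
  have h2 := h.norm_le he.1
  have h3 : (c * k e).re ≤ ‖c‖ := by
    refine (Complex.re_le_norm _).trans ?_
    rw [norm_mul]
    nlinarith [norm_nonneg c, h1.2]
  have h4 : -s * (l e).re ≤ |s| := by
    calc -s * (l e).re ≤ |s| * (l e).re := by gcongr; exacts [h1.1, neg_le_abs s]
      _ ≤ |s| := by nlinarith [abs_nonneg s, h1.2]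
  simp only [tilt]
  linarith

lemma tilt_le_optVal (hl : IsPos l) (hl1 : l 1 = 1) (h : Dom k l) (c : ℂ) (s : ℝ) {e : A}
    (he : e ∈ Set.Icc (0 : A) 1) : tilt k l c s e ≤ optVal k l c s :=
  le_csSup (bddAbove_tilt hl hl1 h c s) ⟨e, he, rfl⟩

lemma optVal_le {c : ℂ} {s t : ℝ} (h : ∀ e ∈ Set.Icc (0 : A) 1, tilt k l c s e ≤ t) :
    optVal k l c s ≤ t := by
  refine csSup_le ⟨_, 0, ⟨le_rfl, zero_le_one⟩, rfl⟩ ?_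
  rintro _ ⟨e, he, rfl⟩
  exact h e he

lemma lipschitzWith_optVal (hl : IsPos l) (hl1 : l 1 = 1) (h : Dom k l) (c : ℂ) :
    LipschitzWith 1 (optVal k l c) := by
  refine LipschitzWith.of_le_add fun s t => optVal_le fun e he => ?_
  have h1 := tilt_le_optVal hl hl1 h c t he
  have h2 := hl.re_mem_Icc hl1 he
  have h3 : (t - s) * (l e).re ≤ dist s t := by
    rw [dist_comm, Real.dist_eq]
    calc (t - s) * (l e).re ≤ |t - s| * (l e).re := by gcongr; exacts [h2.1, le_abs_self _]
      _ ≤ |t - s| := by nlinarith [abs_nonneg (t - s), h2.2]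
  simp only [tilt] at h1 ⊢
  linarith

lemma tendsto_re_of_tendsto_tilt (hl : IsPos l) (hl1 : l 1 = 1) (h : Dom k l) {c : ℂ} {s d : ℝ}
    (hd : HasDerivAt (optVal k l c) (-d) s) {ι : Type*} {F : Filter ι} {x : ι → A}
    (hx : ∀ i, x i ∈ Set.Icc (0 : A) 1)
    (hN : Tendsto (fun i => tilt k l c s (x i)) F (𝓝 (optVal k l c s))) :
    Tendsto (fun i => (l (x i)).re) F (𝓝 d) := by
  rw [Metric.tendsto_nhds]
  intro ε hε
  have h1 := (hasDerivAt_iff_isLittleO_nhds_zero.1 hd).def (show 0 < ε / 4 by positivity)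
  obtain ⟨δ, hδ, h2⟩ := Metric.eventually_nhds_iff.1 h1
  set t := δ / 2 with ht
  have ht0 : 0 < t := by positivity
  have hp := h2 (y := t) (by rw [dist_zero_right, Real.norm_of_nonneg ht0.le]; linarith)
  have hm := h2 (y := -t) (by rw [dist_zero_right, norm_neg, Real.norm_of_nonneg ht0.le]; linarith)
  rw [norm_neg] at hm
  rw [Real.norm_of_nonneg ht0.le, Real.norm_eq_abs, smul_eq_mul, abs_le] at hp hm
  filter_upwards [Metric.tendsto_nhds.1 hN (ε / 4 * t) (by positivity)] with i hi
  rw [Real.dist_eq, abs_lt] at hi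
  have h3 := tilt_le_optVal hl hl1 h c (s + t) (hx i)
  have h4 := tilt_le_optVal hl hl1 h c (s + -t) (hx i)
  simp only [tilt] at h3 h4 hi
  rw [Real.dist_eq, abs_lt]
  constructor
  · have : 0 < t * ((l (x i)).re - d + ε) := by nlinarith
    have := pos_of_mul_pos_right this ht0.le
    linarith
  · have : 0 < t * (ε - ((l (x i)).re - d)) := by nlinarith
    have := pos_of_mul_pos_right this ht0.le
    linarith

lemma tendsto_tilt_mul_self (hl : IsPos l) (hl1 : l 1 = 1) (h : Dom k l) {c : ℂ} {s : ℝ}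
    {ι : Type*} {F : Filter ι} {x : ι → A} (hx : ∀ i, x i ∈ Set.Icc (0 : A) 1)
    (hN : Tendsto (fun i => tilt k l c s (x i)) F (𝓝 (optVal k l c s))) :
    Tendsto (fun i => tilt k l c s (x i * x i)) F (𝓝 (optVal k l c s)) := by
  have h1 : Tendsto (fun i => 2 * tilt k l c s (x i) - optVal k l c s) F (𝓝 (optVal k l c s)) := by
    have := (hN.const_mul 2).sub_const (optVal k l c s)
    convert this using 2
    ring
  refine tendsto_of_tendsto_of_tendsto_of_le_of_le h1 tendsto_const_nhds (fun i => ?_)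
    (fun i => tilt_le_optVal hl hl1 h c s (mul_self_mem_Icc (hx i)))
  have := tilt_le_optVal hl hl1 h c s (two_sub_mul_self_mem_Icc (hx i))
  rw [tilt_sub, tilt_add] at this
  change 2 * tilt k l c s (x i) - optVal k l c s ≤ tilt k l c s (x i * x i)
  linarith

lemma tendsto_re_sub_mul_self (hl : IsPos l) (hl1 : l 1 = 1) (h : Dom k l) {c : ℂ} {s d : ℝ}
    (hd : HasDerivAt (optVal k l c) (-d) s) {ι : Type*} {F : Filter ι} {x : ι → A}
    (hx : ∀ i, x i ∈ Set.Icc (0 : A) 1)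
    (hN : Tendsto (fun i => tilt k l c s (x i)) F (𝓝 (optVal k l c s))) :
    Tendsto (fun i => (l (x i - x i * x i)).re) F (𝓝 0) := by
  have h1 := tendsto_re_of_tendsto_tilt hl hl1 h hd hx hN
  have h2 := tendsto_re_of_tendsto_tilt hl hl1 h hd (fun i => mul_self_mem_Icc (hx i))
    (tendsto_tilt_mul_self hl hl1 h hx hN)
  simpa using h1.sub h2

lemma tendsto_re_sub_sq (hl : IsPos l) (hl1 : l 1 = 1) (h : Dom k l) {c : ℂ} {s d : ℝ}
    (hd : HasDerivAt (optVal k l c) (-d) s) {ι : Type*} {F : Filter ι} {x y : ι → A}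
    (hx : ∀ i, x i ∈ Set.Icc (0 : A) 1) (hy : ∀ i, y i ∈ Set.Icc (0 : A) 1)
    (hNx : Tendsto (fun i => tilt k l c s (x i)) F (𝓝 (optVal k l c s)))
    (hNy : Tendsto (fun i => tilt k l c s (y i)) F (𝓝 (optVal k l c s))) :
    Tendsto (fun i => (l ((x i - y i) * (x i - y i))).re) F (𝓝 0) := by
  have hz : ∀ i, (1 / 2 : ℝ) • x i + (1 / 2 : ℝ) • y i ∈ Set.Icc (0 : A) 1 := fun i =>
    convex_Icc (𝕜 := ℝ) (0 : A) 1 (hx i) (hy i) (by norm_num) (by norm_num) (by norm_num)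
  have hNz : Tendsto (fun i => tilt k l c s ((1 / 2 : ℝ) • x i + (1 / 2 : ℝ) • y i)) F
      (𝓝 (optVal k l c s)) := by
    have := (hNx.const_mul (1 / 2)).add (hNy.const_mul (1 / 2))
    simp only [tilt_add, tilt_smul]
    convert this using 2
    ring
  have h1 := tendsto_re_of_tendsto_tilt hl hl1 h hd (fun i => mul_self_mem_Icc (hx i))
    (tendsto_tilt_mul_self hl hl1 h hx hNx)
  have h2 := tendsto_re_of_tendsto_tilt hl hl1 h hd (fun i => mul_self_mem_Icc (hy i))
    (tendsto_tilt_mul_self hl hl1 h hy hNy)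
  have h3 := tendsto_re_of_tendsto_tilt hl hl1 h hd (fun i => mul_self_mem_Icc (hz i))
    (tendsto_tilt_mul_self hl hl1 h hz hNz)
  have := ((h1.const_mul 2).add (h2.const_mul 2)).sub (h3.const_mul 4)
  convert this using 2 with i
  · simp only [add_mul, mul_add, sub_mul, mul_sub, smul_mul_assoc, mul_smul_comm, map_add, map_sub,
      WeakDual.map_real_smul, Complex.add_re, Complex.sub_re, Complex.re_ofReal_mul]
    ring
  · ring

/-- A net of simultaneous near-optimisers for all unitary conjugates. -/
lemma exists_net {X : Set (WeakDual ℂ A × WeakDual ℂ A)} (hXd : X ⊆ domPairs A)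
    (hXc : Convex ℝ X) (hXu : ∀ p ∈ X, ∀ u : unitary A, (adj u p.1, adj u p.2) ∈ X) (c : ℂ) (s : ℝ)
    (hXm : ∀ t : ℝ, ∀ p ∈ X, (∀ e ∈ Set.Icc (0 : A) 1, tilt p.1 p.2 c s e ≤ t) →
        ∀ q ∈ X, ∀ e ∈ Set.Icc (0 : A) 1, tilt q.1 q.2 c s e ≤ t)
    {p : WeakDual ℂ A × WeakDual ℂ A} (hp : p ∈ X) :
    ∃ e : Finset (unitary A) × ℕ → A, (∀ i, e i ∈ Set.Icc (0 : A) 1) ∧ ∀ u : unitary A,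
      Tendsto (fun i => tilt p.1 p.2 c s ((u : A) * e i * star (u : A))) atTop
        (𝓝 (optVal p.1 p.2 c s)) := by
  obtain ⟨hl, hl1, hd⟩ := hXd hp
  set N := optVal p.1 p.2 c s with hN
  have key : ∀ i : Finset (unitary A) × ℕ, ∃ e ∈ Set.Icc (0 : A) 1, ∀ u ∈ i.1,
      N - 1 / ((i.2 : ℝ) + 1) ≤ tilt p.1 p.2 c s ((u : A) * e * star (u : A)) := by
    rintro ⟨T, n⟩
    simp only
    rcases T.eq_empty_or_nonempty with rfl | hT
    · exact ⟨0, ⟨le_rfl, zero_le_one⟩, by simp⟩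
    set m : ℝ := (T.card : ℝ) with hm
    have hm0 : 0 < m := by
      rw [hm]; exact_mod_cast hT.card_pos
    set q : WeakDual ℂ A × WeakDual ℂ A := ∑ u ∈ T, (1 / m) • (adj u p.1, adj u p.2) with hq
    have hqX : q ∈ X := by
      refine hXc.sum_mem (fun _ _ => by positivity) ?_ (fun u _ => hXu p hp u)
      rw [Finset.sum_const, nsmul_eq_mul, ← hm]
      field_simp
    have hqt : ∀ e, tilt q.1 q.2 c s e =
        ∑ u ∈ T, (1 / m) * tilt p.1 p.2 c s ((u : A) * e * star (u : A)) := by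
      intro e
      have h1 : ∀ S : Finset (unitary A),
          tilt (∑ u ∈ S, (1 / m) • (adj u p.1, adj u p.2)).1
            (∑ u ∈ S, (1 / m) • (adj u p.1, adj u p.2)).2 c s e =
          ∑ u ∈ S, (1 / m) * tilt p.1 p.2 c s ((u : A) * e * star (u : A)) := by
        classical
        intro S
        induction S using Finset.induction_on with
        | empty => simp [tilt]
        | insert u S hu ih =>
          rw [Finset.sum_insert hu, Finset.sum_insert hu, ← ih]
          simp only [tilt, Prod.fst_add, Prod.snd_add, Prod.smul_fst, Prod.smul_snd,
            WeakDual.add_apply', WeakDual.real_smul_apply, adj_apply, mul_add, Complex.add_re,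
            mul_left_comm c, Complex.re_ofReal_mul]
          ring
      exact h1 T
    obtain ⟨e, he, hlt⟩ : ∃ e ∈ Set.Icc (0 : A) 1,
        N - 1 / (((n : ℝ) + 1) * m) < tilt q.1 q.2 c s e := by
      by_contra! hcon
      have h1 := hXm _ q hqX hcon p hp
      have h2 := optVal_le h1
      have : 0 < 1 / (((n : ℝ) + 1) * m) := by positivity
      linarith
    refine ⟨e, he, fun u hu => ?_⟩
    by_contra! hcon
    have h1 : ∑ v ∈ T, tilt p.1 p.2 c s ((v : A) * e * star (v : A)) <
        m * N - 1 / ((n : ℝ) + 1) := by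
      classical
      rw [← Finset.add_sum_erase T _ hu]
      have h2 : ∑ v ∈ T.erase u, tilt p.1 p.2 c s ((v : A) * e * star (v : A)) ≤
          ∑ v ∈ T.erase u, N := Finset.sum_le_sum fun v _ =>
            tilt_le_optVal hl hl1 hd c s (conj_mem_Icc he v)
      rw [Finset.sum_const, Finset.card_erase_of_mem hu, nsmul_eq_mul,
        Nat.cast_sub hT.card_pos, ← hm] at h2
      push_cast at h2
      linarith
    rw [hqt, ← Finset.mul_sum] at hlt
    have h3 := mul_lt_mul_of_pos_left h1 (one_div_pos.2 hm0)
    have h4 : 1 / m * (m * N - 1 / ((n : ℝ) + 1)) = N - 1 / (((n : ℝ) + 1) * m) := by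
      field_simp
    linarith
  choose e he hu using key
  refine ⟨e, he, fun u => ?_⟩
  have h1 : Tendsto (fun i : Finset (unitary A) × ℕ => N - 1 / ((i.2 : ℝ) + 1)) atTop (𝓝 N) := by
    have : Tendsto (fun i : Finset (unitary A) × ℕ => i.2) atTop atTop := by
      rw [← prod_atTop_atTop_eq]; exact tendsto_snd
    have := (tendsto_one_div_add_atTop_nhds_zero_nat (𝕜 := ℝ)).comp this
    simpa using this.const_sub N
  refine tendsto_of_tendsto_of_tendsto_of_le_of_le' h1 tendsto_const_nhds ?_
    (Eventually.of_forall fun i => tilt_le_optVal hl hl1 hd c s (conj_mem_Icc (he i) u))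
  filter_upwards [eventually_ge_atTop (({u} : Finset (unitary A)), 0)] with i hi
  exact hu i u (hi.1 (by simp))

end order

section partialOrder

variable [PartialOrder A]

/-- A net of elements of `[0,1]` that, in the seminorm given by `l`, is asymptotically
projection-valued and invariant under unitary conjugation. -/
structure AsympCentral (l : WeakDual ℂ A) {ι : Type*} (F : Filter ι) (e : ι → A) : Prop where
  mem : ∀ i, e i ∈ Set.Icc (0 : A) 1
  sub_mul_self : ∀ u : unitary A, Tendsto (fun i => (l ((u : A) * e i * star (u : A) -
    (u : A) * e i * star (u : A) * ((u : A) * e i * star (u : A)))).re) F (𝓝 0)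
  sub_conj : ∀ u : unitary A, Tendsto (fun i => (l ((e i - (u : A) * e i * star (u : A)) *
    (e i - (u : A) * e i * star (u : A)))).re) F (𝓝 0)

lemma AsympCentral.mono {l : WeakDual ℂ A} {ι : Type*} {F G : Filter ι} {e : ι → A}
    (h : AsympCentral l F e) (hG : G ≤ F) : AsympCentral l G e :=
  ⟨h.mem, fun u => (h.sub_mul_self u).mono_left hG, fun u => (h.sub_conj u).mono_left hG⟩

end partialOrder

section order

variable [PartialOrder A] [StarOrderedRing A]

lemma IsPos.re_mul_star_nonneg {l : WeakDual ℂ A} (hl : IsPos l) (y : A) :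
    0 ≤ (l (y * star y)).re := hl.re_nonneg (mul_star_self_nonneg y)

lemma IsPos.re_add_mul_star_add_le {l : WeakDual ℂ A} (hl : IsPos l) (x y : A) :
    (l ((x + y) * star (x + y))).re ≤ 2 * (l (x * star x)).re + 2 * (l (y * star y)).re := by
  have := hl.re_mul_star_nonneg (x - y)
  simp only [star_add, star_sub, add_mul, mul_add, sub_mul, mul_sub, map_add, map_sub,
    Complex.add_re, Complex.sub_re] at this ⊢
  linarith

namespace AsympCentral

variable {k l : WeakDual ℂ A} {ι : Type*} {F : Filter ι} {e : ι → A}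

lemma one_sub (h : AsympCentral l F e) : AsympCentral l F (fun i => 1 - e i) := by
  have hc : ∀ (u : unitary A) i, (u : A) * (1 - e i) * star (u : A) =
      1 - (u : A) * e i * star (u : A) := fun u i => by
    rw [mul_sub, sub_mul, mul_one, Unitary.mul_star_self_of_mem u.2]
  refine ⟨fun i => ⟨sub_nonneg.2 (h.mem i).2, sub_le_self _ (h.mem i).1⟩, fun u => ?_, fun u => ?_⟩
  · refine (h.sub_mul_self u).congr fun i => ?_
    rw [hc]
    congr 2
    noncomm_ring
  · refine (h.sub_conj u).congr fun i => ?_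
    rw [hc]
    congr 2
    noncomm_ring

lemma tendsto_re (hl : IsPos l) (h : AsympCentral l F e) (u : unitary A) :
    Tendsto (fun i => (l ((e i * u * (1 - e i)) * star (e i * u * (1 - e i)))).re) F (𝓝 0) := by
  have h1 := ((h.sub_conj u).const_mul 2).add ((h.sub_mul_self u).const_mul 2)
  simp only [mul_zero, add_zero] at h1
  refine squeeze_zero (fun i => hl.re_mul_star_nonneg _) (fun i => ?_) h1
  set c := (u : A) * e i * star (u : A) with hc
  have hcm : c ∈ Set.Icc (0 : A) 1 := conj_mem_Icc (h.mem i) u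
  have hcs : star c = c := hcm.1.isSelfAdjoint.star_eq
  have hes : star (e i) = e i := (h.mem i).1.isSelfAdjoint.star_eq
  have huu : star (u : A) * u = 1 := Unitary.coe_star_mul_self u
  have huu' : (u : A) * star (u : A) = 1 := Unitary.coe_mul_star_self u
  have e1 : e i * u * (1 - e i) = (e i - c) * (1 - c) * u + (c - c * c) * u := by
    have : c * u = u * e i := by rw [hc, mul_assoc, huu, mul_one]
    have h2 : e i * u * e i = e i * (c * u) := by rw [this, mul_assoc]
    rw [mul_sub, mul_one, h2]
    noncomm_ring
  have hu : ∀ y : A, y * u * star (y * u) = y * star y := fun y => by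
    rw [star_mul, mul_assoc, ← mul_assoc (u : A), huu', one_mul]
  rw [e1]
  refine (hl.re_add_mul_star_add_le _ _).trans ?_
  rw [hu, hu]
  have h1c : (1 - c) ∈ Set.Icc (0 : A) 1 := ⟨sub_nonneg.2 hcm.2, sub_le_self _ hcm.1⟩
  have hg : c - c * c ∈ Set.Icc (0 : A) 1 :=
    ⟨sub_mul_self_nonneg hcm, (sub_le_self _ (mul_self_mem_Icc hcm).1).trans hcm.2⟩
  gcongr 2 * ?_ + 2 * ?_
  · apply hl.mono
    have := star_right_conjugate_le_conjugate (mul_self_mem_Icc h1c).2 (e i - c)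
    rw [mul_one, star_sub, hes, hcs] at this
    convert this using 1
    rw [star_mul, star_sub, star_sub, star_one, hes, hcs]
    noncomm_ring
  · apply hl.mono
    rw [hg.1.isSelfAdjoint.star_eq]
    exact sub_nonneg.1 (sub_mul_self_nonneg hg)

lemma tendsto_sn (hl : IsPos l) (h : AsympCentral l F e) (u : unitary A) :
    Tendsto (fun i => sn l (e i * u * (1 - e i))) F (𝓝 0) := by
  have := (h.tendsto_re hl u).sqrt
  rwa [Real.sqrt_zero] at this

lemma tendsto_apply (hl : IsPos l) (hk : Dom k l) (h : AsympCentral l F e) (x : A) :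
    Tendsto (fun i => k (e i * x * (1 - e i))) F (𝓝 0) := by
  have hx : x ∈ Submodule.span ℂ (unitary A : Set A) := by
    rw [CStarAlgebra.span_unitary]; trivial
  induction hx using Submodule.span_induction with
  | mem x hx =>
    rw [tendsto_zero_iff_norm_tendsto_zero]
    have h1 := (h.tendsto_sn hl ⟨x, hx⟩).const_mul (2 * sn l 1)
    rw [mul_zero] at h1
    refine squeeze_zero (fun i => norm_nonneg _) (fun i => ?_) h1
    have := hk.norm_apply_mul_mul_star_le hl (e i * x * (1 - e i)) 1 1
    simp only [mul_one, star_one] at this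
    have h1 : ‖(1 : A)‖ ≤ 1 := (CStarAlgebra.norm_le_one_iff_of_nonneg 1 zero_le_one).2 le_rfl
    refine this.trans ?_
    have := mul_nonneg (sn_nonneg l (e i * x * (1 - e i))) (sn_nonneg l 1)
    simp only
    nlinarith
  | zero => simpa using tendsto_const_nhds
  | add x y _ _ hx hy =>
    simp only [mul_add, add_mul, map_add]
    simpa using hx.add hy
  | smul c x _ hx =>
    simp only [mul_smul_comm, smul_mul_assoc, map_smul]
    simpa using hx.const_smul c

end AsympCentral

end order

lemma exists_forall_tendsto_of_ultrafilter {ι : Type*} (𝒰 : Ultrafilter ι) (g : ι → WeakDual ℂ A)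
    {C : ℝ} (hg : ∀ i x, ‖g i x‖ ≤ C * ‖x‖) :
    ∃ f : WeakDual ℂ A, ∀ x, Tendsto (fun i => g i x) 𝒰 (𝓝 (f x)) := by
  obtain ⟨f, -, hf⟩ := (isCompact_setOf_norm_le C).ultrafilter_le_nhds' (𝒰.map g)
    (Ultrafilter.mem_map.2 (Filter.univ_mem' fun i => hg i))
  refine ⟨f, fun x => ?_⟩
  exact ((WeakDual.eval_continuous x).tendsto f).comp hf

section order

variable [PartialOrder A] [StarOrderedRing A]

lemma norm_conj_add_conj_le_one {e : A} (he : e ∈ Set.Icc (0 : A) 1) (u v : unitary A) :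
    ‖e * u * e + (1 - e) * v * (1 - e)‖ ≤ 1 := by
  have hes : star e = e := he.1.isSelfAdjoint.star_eq
  set w := e * u * e + (1 - e) * v * (1 - e) with hw
  have huu : star (u : A) * u = 1 := Unitary.star_mul_self_of_mem u.2
  have hvv : star (v : A) * v = 1 := Unitary.star_mul_self_of_mem v.2
  have h1 := add_nonneg (star_mul_self_nonneg ((u : A) * e - e * w))
    (star_mul_self_nonneg ((v : A) * (1 - e) - (1 - e) * w))
  have hq : e * e + (1 - e) * (1 - e) ≤ 1 := by
    have := add_nonneg (sub_mul_self_nonneg he) (sub_mul_self_nonneg he)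
    rw [← sub_nonneg]
    convert this using 1
    noncomm_ring
  have h2 := star_left_conjugate_le_conjugate hq w
  have hstar : star w = e * star (u : A) * e + (1 - e) * star (v : A) * (1 - e) := by
    simp only [hw, star_add, star_mul, star_sub, star_one, hes, mul_assoc]
  have h3 : star ((u : A) * e - e * w) * ((u : A) * e - e * w) +
      star ((v : A) * (1 - e) - (1 - e) * w) * ((v : A) * (1 - e) - (1 - e) * w) =
      e * (star (u : A) * u) * e + (1 - e) * (star (v : A) * v) * (1 - e)
        - (star w * (e * u * e + (1 - e) * v * (1 - e)))
        - (e * star (u : A) * e + (1 - e) * star (v : A) * (1 - e)) * w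
        + star w * (e * e + (1 - e) * (1 - e)) * w := by
    simp only [star_sub, star_mul, star_one, hes]
    noncomm_ring
  rw [h3, huu, hvv, ← hstar, ← hw, mul_one, mul_one] at h1
  rw [mul_one] at h2
  have h4 : star w * w ≤ 1 := by
    refine le_trans ?_ hq
    rw [← sub_nonneg] at h2 ⊢
    convert add_nonneg h1 h2 using 1
    noncomm_ring
  rw [← CStarAlgebra.norm_le_one_iff_of_nonneg _ (star_mul_self_nonneg w),
    CStarRing.norm_star_mul_self] at h4
  nlinarith [norm_nonneg w]

lemma IsPos.sn_le {l : WeakDual ℂ A} (hl : IsPos l) {y : A} (hy : ‖y‖ ≤ 1) :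
    sn l y ≤ √(2 * (l 1).re) := by
  apply Real.sqrt_le_sqrt
  refine (Complex.re_le_norm _).trans ((hl.dom_self.norm_apply_le hl _).trans ?_)
  rw [CStarRing.norm_self_mul_star]
  have h1 : ‖y‖ * ‖y‖ ≤ 1 := by nlinarith [norm_nonneg y]
  have h2 : 0 ≤ (l 1).re := hl.re_nonneg zero_le_one
  nlinarith

namespace AsympCentral

variable {k l : WeakDual ℂ A} {ι : Type*} {F : Filter ι} {e : ι → A}

lemma tendsto_apply' (hl : IsPos l) (hk : Dom k l) (h : AsympCentral l F e) (x : A) :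
    Tendsto (fun i => k ((1 - e i) * x * e i)) F (𝓝 0) := by
  simpa using h.one_sub.tendsto_apply hl hk x

lemma tendsto_conj_add_conj (hl : IsPos l) (hk : Dom k l) (h : AsympCentral l F e)
    {k₁ k₂ : WeakDual ℂ A} (h₁ : ∀ x, Tendsto (fun i => k (e i * x * e i)) F (𝓝 (k₁ x)))
    (h₂ : ∀ x, Tendsto (fun i => k ((1 - e i) * x * (1 - e i))) F (𝓝 (k₂ x)))
    (u v : unitary A) (x : A) :
    Tendsto (fun i => k ((e i * u * e i + (1 - e i) * v * (1 - e i)) * x *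
      star (e i * u * e i + (1 - e i) * v * (1 - e i)))) F
      (𝓝 (k₁ ((u : A) * x * star (u : A)) + k₂ ((v : A) * x * star (v : A)))) := by
  set w : ι → A := fun i => e i * u * e i + (1 - e i) * v * (1 - e i) with hw
  set d : ι → A := fun i => e i * u * (1 - e i) + (1 - e i) * v * e i with hd
  have hwn : ∀ i, ‖w i‖ ≤ 1 := fun i => norm_conj_add_conj_le_one (h.mem i) u v
  have hdn : Tendsto (fun i => sn l (d i)) F (𝓝 0) := by
    have h1 := (((h.tendsto_re hl u).const_mul 2).add
      ((h.one_sub.tendsto_re hl v).const_mul 2)).sqrt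
    simp only [mul_zero, add_zero, Real.sqrt_zero, sub_sub_cancel] at h1
    exact squeeze_zero (fun i => sn_nonneg _ _)
      (fun i => Real.sqrt_le_sqrt (hl.re_add_mul_star_add_le _ _)) h1
  have hwb : ∀ i, sn l (w i) ≤ √(2 * (l 1).re) := fun i => hl.sn_le (hwn i)
  have t1 : Tendsto (fun i => k (w i * x * star (d i))) F (𝓝 0) := by
    rw [tendsto_zero_iff_norm_tendsto_zero]
    have := hdn.const_mul (2 * ‖x‖ * √(2 * (l 1).re))
    rw [mul_zero] at this
    refine squeeze_zero (fun i => norm_nonneg _) (fun i => ?_) this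
    refine (hk.norm_apply_mul_mul_star_le hl _ _ _).trans ?_
    gcongr
    exacts [sn_nonneg _ _, hwb i]
  have t2 : Tendsto (fun i => k (d i * x * star (w i))) F (𝓝 0) := by
    rw [tendsto_zero_iff_norm_tendsto_zero]
    have := (hdn.const_mul (2 * ‖x‖)).mul_const (√(2 * (l 1).re))
    rw [mul_zero, zero_mul] at this
    refine squeeze_zero (fun i => norm_nonneg _) (fun i => ?_) this
    refine (hk.norm_apply_mul_mul_star_le hl _ _ _).trans ?_
    have := sn_nonneg l (d i)
    gcongr
    exact hwb i
  have t3 : Tendsto (fun i => k (d i * x * star (d i))) F (𝓝 0) := by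
    rw [tendsto_zero_iff_norm_tendsto_zero]
    have := (hdn.const_mul (2 * ‖x‖)).mul hdn
    rw [mul_zero] at this
    exact squeeze_zero (fun i => norm_nonneg _)
      (fun i => hk.norm_apply_mul_mul_star_le hl _ _ _) this
  have t4 : Tendsto (fun i => k ((w i + d i) * x * star (w i + d i))) F
      (𝓝 (k₁ ((u : A) * x * star (u : A)) + k₂ ((v : A) * x * star (v : A)))) := by
    have := (((h₁ ((u : A) * x * star (u : A))).add (h₂ ((v : A) * x * star (v : A)))).add
      (h.tendsto_apply hl hk ((u : A) * x * star (v : A)))).add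
      (h.tendsto_apply' hl hk ((v : A) * x * star (u : A)))
    rw [add_zero, add_zero] at this
    refine this.congr fun i => ?_
    have hes : star (e i) = e i := (h.mem i).1.isSelfAdjoint.star_eq
    have e1 : w i + d i = e i * u + (1 - e i) * v := by
      simp only [hw, hd]; noncomm_ring
    rw [e1, ← map_add, ← map_add, ← map_add]
    congr 1
    simp only [star_add, star_mul, star_sub, star_one, hes]
    noncomm_ring
  have t5 := ((t4.sub t1).sub t2).sub t3
  simp only [sub_zero] at t5
  refine t5.congr fun i => ?_
  change _ = k (w i * x * star (w i))
  generalize w i = y, d i = z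
  rw [← map_sub, ← map_sub, ← map_sub]
  congr 1
  simp only [star_add]
  noncomm_ring

/-- Splitting a dominated pair along an asymptotically central net. -/
lemma exists_split {𝒰 : Ultrafilter ι} (hl : IsPos l) (hk : Dom k l) (h : AsympCentral l 𝒰 e)
    {a : A} {r : ℝ} (hr : ∀ u : unitary A, r ≤ (k ((u : A) * a * star (u : A))).re) :
    ∃ k₁ l₁ k₂ l₂ : WeakDual ℂ A, IsPos l₁ ∧ IsPos l₂ ∧ Dom k₁ l₁ ∧ Dom k₂ l₂ ∧
      (∀ x, k₁ x + k₂ x = k x) ∧ (∀ x, l₁ x + l₂ x = l x) ∧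
      (∀ x, Tendsto (fun i => k (e i * x * e i)) 𝒰 (𝓝 (k₁ x))) ∧
      (∀ x, Tendsto (fun i => l (e i * x * e i)) 𝒰 (𝓝 (l₁ x))) ∧
      ∀ u v : unitary A, r ≤ (k₁ ((u : A) * a * star (u : A))).re +
        (k₂ ((v : A) * a * star (v : A))).re := by
  have hcompr : ∀ κ : WeakDual ℂ A, Dom κ l → ∀ f : ι → A, (∀ i, f i ∈ Set.Icc (0 : A) 1) →
      ∃ κ' : WeakDual ℂ A, ∀ x, Tendsto (fun i => κ (f i * x * f i)) 𝒰 (𝓝 (κ' x)) := by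
    intro κ hκ f hf
    have := exists_forall_tendsto_of_ultrafilter 𝒰 (fun i => sandwich (f i) (f i) κ)
      (C := 2 * (l 1).re) (fun i x => ?_)
    · simpa using this
    · rw [sandwich_apply]
      refine (hκ.norm_apply_le hl _).trans ?_
      have h1 : ‖f i‖ ≤ 1 := (CStarAlgebra.norm_le_one_iff_of_nonneg _ (hf i).1).2 (hf i).2
      have h2 : 0 ≤ (l 1).re := hl.re_nonneg zero_le_one
      gcongr
      calc ‖f i * x * f i‖ ≤ ‖f i‖ * ‖x‖ * ‖f i‖ :=
            (norm_mul_le _ _).trans (by gcongr; exact norm_mul_le _ _)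
        _ ≤ 1 * ‖x‖ * 1 := by gcongr
        _ = ‖x‖ := by ring
  have hconj : ∀ f : ι → A, (∀ i, f i ∈ Set.Icc (0 : A) 1) → ∀ x : A, 0 ≤ x → ∀ i,
      0 ≤ f i * x * f i := by
    intro f hf x hx i
    simpa [(hf i).1.isSelfAdjoint.star_eq] using star_right_conjugate_nonneg hx (f i)
  obtain ⟨k₁, hk₁⟩ := hcompr k hk e h.mem
  obtain ⟨l₁, hl₁⟩ := hcompr l hl.dom_self e h.mem
  obtain ⟨k₂, hk₂⟩ := hcompr k hk _ h.one_sub.mem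
  obtain ⟨l₂, hl₂⟩ := hcompr l hl.dom_self _ h.one_sub.mem
  have hpos : ∀ (f : ι → A) (l' : WeakDual ℂ A), (∀ i, f i ∈ Set.Icc (0 : A) 1) →
      (∀ x, Tendsto (fun i => l (f i * x * f i)) 𝒰 (𝓝 (l' x))) → IsPos l' := by
    intro f l' hf hl'
    rw [isPos_iff]
    intro x hx
    exact ge_of_tendsto (hl' x) (Eventually.of_forall fun i => hl.nonneg (hconj f hf x hx i))
  have hdom : ∀ (f : ι → A) (k' l' : WeakDual ℂ A), (∀ i, f i ∈ Set.Icc (0 : A) 1) →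
      (∀ x, Tendsto (fun i => k (f i * x * f i)) 𝒰 (𝓝 (k' x))) →
      (∀ x, Tendsto (fun i => l (f i * x * f i)) 𝒰 (𝓝 (l' x))) → Dom k' l' := by
    intro f k' l' hf hk' hl'
    rw [dom_iff]
    intro x hx
    exact le_of_tendsto_of_tendsto (hk' x).norm ((Complex.continuous_re.tendsto _).comp (hl' x))
      (Eventually.of_forall fun i => hk.norm_le (hconj f hf x hx i))
  have hadd : ∀ κ κ₁ κ₂ : WeakDual ℂ A, Dom κ l →
      (∀ x, Tendsto (fun i => κ (e i * x * e i)) 𝒰 (𝓝 (κ₁ x))) →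
      (∀ x, Tendsto (fun i => κ ((1 - e i) * x * (1 - e i))) 𝒰 (𝓝 (κ₂ x))) →
      ∀ x, κ₁ x + κ₂ x = κ x := by
    intro κ κ₁ κ₂ hκ h1 h2 x
    have h3 := (((h1 x).add (h2 x)).add (h.tendsto_apply hl hκ x)).add (h.tendsto_apply' hl hκ x)
    rw [add_zero, add_zero] at h3
    refine tendsto_nhds_unique h3 (tendsto_const_nhds.congr fun i => ?_)
    rw [← map_add, ← map_add, ← map_add]
    congr 1
    noncomm_ring
  refine ⟨k₁, l₁, k₂, l₂, hpos _ _ h.mem hl₁, hpos _ _ h.one_sub.mem hl₂,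
    hdom _ _ _ h.mem hk₁ hl₁, hdom _ _ _ h.one_sub.mem hk₂ hl₂, hadd _ _ _ hk hk₁ hk₂,
    hadd _ _ _ hl.dom_self hl₁ hl₂, hk₁, hl₁, fun u v => ?_⟩
  have t1 := (Complex.continuous_re.tendsto _).comp (h.tendsto_conj_add_conj hl hk hk₁ hk₂ u v a)
  have t2 := (Complex.continuous_re.tendsto _).comp
    (h.tendsto_conj_add_conj hl hl.dom_self hl₁ hl₂ u v 1)
  rw [mul_one, mul_one, Unitary.mul_star_self_of_mem u.2, Unitary.mul_star_self_of_mem v.2,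
    hadd _ _ _ hl.dom_self hl₁ hl₂] at t2
  have t3 := t1.add ((t2.const_sub (l 1).re).const_mul (2 * ‖a‖))
  rw [sub_self, mul_zero, add_zero, Complex.add_re] at t3
  refine ge_of_tendsto t3 (Eventually.of_forall fun i => ?_)
  have := hk.le_of_contraction hl hr (norm_conj_add_conj_le_one (h.mem i) u v)
  simpa using this

end AsympCentral

end order

lemma Complex.eq_smul_of_norm_le {p q z : ℂ} {t : ℝ} (h : p + q = z) (ht : t ≤ 1) (ht0 : 0 ≤ t)
    (hp : ‖p‖ ≤ ‖z‖ * t) (hq : ‖q‖ ≤ ‖z‖ * (1 - t)) : p = t * z := by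
  obtain rfl : q = z - p := by rw [← h]; ring
  have h1 : ‖p‖ ^ 2 ≤ (‖z‖ * t) ^ 2 := by gcongr
  have h2 : ‖z - p‖ ^ 2 ≤ (‖z‖ * (1 - t)) ^ 2 := by gcongr
  rw [mul_pow] at h1 h2
  simp only [Complex.sq_norm, Complex.normSq_apply, Complex.sub_re, Complex.sub_im] at h1 h2
  have h3 := mul_le_mul_of_nonneg_left h2 ht0
  have h4 := mul_le_mul_of_nonneg_left h1 (sub_nonneg.2 ht)
  have h5 : (p.re - t * z.re) ^ 2 + (p.im - t * z.im) ^ 2 ≤ 0 := by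
    nlinarith
  apply Complex.ext
  · simp only [Complex.re_ofReal_mul]
    nlinarith [sq_nonneg (p.re - t * z.re), sq_nonneg (p.im - t * z.im)]
  · simp only [Complex.im_ofReal_mul]
    nlinarith [sq_nonneg (p.re - t * z.re), sq_nonneg (p.im - t * z.im)]

section order

variable [PartialOrder A] [StarOrderedRing A]

lemma smul_mem_domPairs {k l : WeakDual ℂ A} (hl : IsPos l) (hk : Dom k l) (h0 : 0 < (l 1).re) :
    ((l 1).re⁻¹ • k, (l 1).re⁻¹ • l) ∈ domPairs A := by
  have h1 : 0 ≤ (l 1).re⁻¹ := by positivity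
  refine ⟨fun x => ?_, ?_, fun x => ?_⟩
  · simp only [WeakDual.real_smul_apply]
    exact mul_nonneg (by exact_mod_cast h1) (hl x)
  · simp only [WeakDual.real_smul_apply]
    rw [hl.eq_re (IsSelfAdjoint.one A), Complex.ofReal_re, ← Complex.ofReal_mul,
      inv_mul_cancel₀ h0.ne', Complex.ofReal_one]
  · simp only [WeakDual.real_smul_apply, norm_mul, Complex.re_ofReal_mul, Complex.norm_real,
      Real.norm_of_nonneg h1]
    gcongr
    exact hk x

lemma Dom.apply_eq_zero {k l : WeakDual ℂ A} (hk : Dom k l) (hl : IsPos l) (h0 : (l 1).re = 0)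
    (x : A) : k x = 0 := by
  simpa [h0] using hk.norm_apply_le hl x

lemma le_mul_of_forall_domPairs {a : A} {r : ℝ} (hr : ∀ p ∈ domPairs A, ∀ r' : ℝ,
      (∀ u : unitary A, r' ≤ (p.1 ((u : A) * a * star (u : A))).re) → r' ≤ r)
    {k l : WeakDual ℂ A} (hl : IsPos l) (hk : Dom k l) {r' : ℝ}
    (h : ∀ u : unitary A, r' ≤ (k ((u : A) * a * star (u : A))).re) : r' ≤ r * (l 1).re := by
  rcases (hl.re_nonneg zero_le_one).eq_or_lt with h0 | h0
  · have := h 1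
    rw [hk.apply_eq_zero hl h0.symm] at this
    simpa [← h0] using this
  · have := hr _ (smul_mem_domPairs hl hk h0) ((l 1).re⁻¹ * r') (fun u => by
      simp only [WeakDual.real_smul_apply, Complex.re_ofReal_mul]
      gcongr
      exact h u)
    rwa [inv_mul_le_iff₀ h0, mul_comm] at this

lemma norm_apply_one_le_of_forall_domPairs {a : A} {r C : ℝ} (hr : ∀ p ∈ domPairs A,
      (∀ u : unitary A, r ≤ (p.1 ((u : A) * a * star (u : A))).re) → ‖p.1 1‖ ≤ C)
    {k l : WeakDual ℂ A} (hl : IsPos l) (hk : Dom k l)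
    (h : ∀ u : unitary A, r * (l 1).re ≤ (k ((u : A) * a * star (u : A))).re) :
    ‖k 1‖ ≤ C * (l 1).re := by
  rcases (hl.re_nonneg zero_le_one).eq_or_lt with h0 | h0
  · rw [hk.apply_eq_zero hl h0.symm, ← h0]
    simp
  · have := hr _ (smul_mem_domPairs hl hk h0) (fun u => by
      simp only [WeakDual.real_smul_apply, Complex.re_ofReal_mul]
      rw [le_inv_mul_iff₀ h0, mul_comm]
      exact h u)
    simp only [WeakDual.real_smul_apply, norm_mul, Complex.norm_real,
      Real.norm_of_nonneg (inv_nonneg.2 h0.le)] at this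
    rwa [inv_mul_le_iff₀ h0, mul_comm] at this

/-- At points of differentiability, the optimal value is attained on a multiple of `k 1`. -/
lemma optVal_le_max {a : A} {r : ℝ} {z : ℂ} {X : Set (WeakDual ℂ A × WeakDual ℂ A)}
    (hmax : ∀ p ∈ domPairs A, ∀ r' : ℝ,
      (∀ u : unitary A, r' ≤ (p.1 ((u : A) * a * star (u : A))).re) → r' ≤ r)
    (hz : ∀ p ∈ domPairs A, (∀ u : unitary A, r ≤ (p.1 ((u : A) * a * star (u : A))).re) →
        ‖p.1 1‖ ≤ ‖z‖)
    (hXd : X ⊆ domPairs A)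
    (hXz : ∀ p ∈ X, p.1 1 = z ∧ ∀ u : unitary A, r ≤ (p.1 ((u : A) * a * star (u : A))).re)
    (hXc : Convex ℝ X) (hXu : ∀ p ∈ X, ∀ u : unitary A, (adj u p.1, adj u p.2) ∈ X)
    (c : ℂ) (s : ℝ)
    (hXm : ∀ t : ℝ, ∀ p ∈ X, (∀ e ∈ Set.Icc (0 : A) 1, tilt p.1 p.2 c s e ≤ t) →
        ∀ q ∈ X, ∀ e ∈ Set.Icc (0 : A) 1, tilt q.1 q.2 c s e ≤ t)
    {k l : WeakDual ℂ A} (hp : (k, l) ∈ X) (hd : DifferentiableAt ℝ (optVal k l c) s) :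
    optVal k l c s ≤ max ((c * z).re - s) 0 := by
  classical
  obtain ⟨hl, hl1, hk⟩ := hXd hp
  obtain ⟨hkz, hkr⟩ := hXz _ hp
  simp only at hl hl1 hk hkz hkr
  obtain ⟨e, he, hlim⟩ := exists_net hXd hXc hXu c s hXm hp
  simp only at hlim
  have hd' : HasDerivAt (optVal k l c) (-(-deriv (optVal k l c) s)) s := by
    rw [neg_neg]; exact hd.hasDerivAt
  have hlim1 : Tendsto (fun i => tilt k l c s (e i)) atTop (𝓝 (optVal k l c s)) := by
    simpa using hlim 1
  have hac : AsympCentral l atTop e := by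
    refine ⟨he, fun u => ?_, fun u => ?_⟩
    · exact tendsto_re_sub_mul_self hl hl1 hk hd' (fun i => conj_mem_Icc (he i) u) (hlim u)
    · exact tendsto_re_sub_sq hl hl1 hk hd' he (fun i => conj_mem_Icc (he i) u) hlim1 (hlim u)
  obtain ⟨k₁, l₁, k₂, l₂, hl₁, hl₂, hk₁, hk₂, hkk, hll, tk, tl, hsplit⟩ :=
    (hac.mono (Ultrafilter.of_le (f := atTop))).exists_split hl hk hkr
  have hsum : (l₁ 1).re + (l₂ 1).re = 1 := by
    rw [← Complex.add_re, hll, hl1, Complex.one_re]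
  have h1 : ∀ u : unitary A, r * (l₁ 1).re ≤ (k₁ ((u : A) * a * star (u : A))).re := by
    intro u
    have := le_mul_of_forall_domPairs hmax hl₂ hk₂
      (r' := r - (k₁ ((u : A) * a * star (u : A))).re) (fun v => by linarith [hsplit u v])
    have h3 : (l₁ 1).re = 1 - (l₂ 1).re := by linarith
    rw [h3]
    linarith
  have h2 : ∀ u : unitary A, r * (l₂ 1).re ≤ (k₂ ((u : A) * a * star (u : A))).re := by
    intro u
    have := le_mul_of_forall_domPairs hmax hl₁ hk₁
      (r' := r - (k₂ ((u : A) * a * star (u : A))).re) (fun v => by linarith [hsplit v u])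
    have h3 : (l₂ 1).re = 1 - (l₁ 1).re := by linarith
    rw [h3]
    linarith
  have h3 := norm_apply_one_le_of_forall_domPairs hz hl₁ hk₁ h1
  have h4 := norm_apply_one_le_of_forall_domPairs hz hl₂ hk₂ h2
  have p1 := hl₁.re_nonneg (zero_le_one (α := A))
  have p2 := hl₂.re_nonneg (zero_le_one (α := A))
  have h5 : k₁ 1 = ((l₁ 1).re : ℝ) * z := by
    refine Complex.eq_smul_of_norm_le ((hkk 1).trans hkz) (by linarith) p1 h3 ?_
    rwa [← hsum, add_sub_cancel_left]
  have h6 := (tendsto_tilt_mul_self hl hl1 hk he hlim1).mono_left (Ultrafilter.of_le (f := atTop))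
  have h7 : Tendsto (fun i => tilt k l c s (e i * e i))
      (Ultrafilter.of (atTop : Filter (Finset (unitary A) × ℕ)))
      (𝓝 ((c * k₁ 1).re - s * (l₁ 1).re)) := by
    have t1 := (Complex.continuous_re.tendsto _).comp ((tk 1).const_mul c)
    have t2 := ((Complex.continuous_re.tendsto _).comp (tl 1)).const_mul s
    simpa [tilt, Function.comp_def] using t1.sub t2
  have h8 := tendsto_nhds_unique h6 h7
  rw [h8, h5, mul_left_comm, Complex.re_ofReal_mul]
  have h9 : (l₁ 1).re * (c * z).re - s * (l₁ 1).re = (l₁ 1).re * ((c * z).re - s) := by ring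
  rw [h9]
  rcases le_total 0 ((c * z).re - s) with h | h
  · exact le_max_of_le_left (by nlinarith)
  · exact le_max_of_le_right (by nlinarith)

/-- If `0 ∉ D_A(a)`, then some rotation of `a` is separated from `0` by a single state. -/
lemma exists_state_of_zero_notMem {a : A} (h : (0 : A) ∉ dixmierSet a) :
    ∃ (l : WeakDual ℂ A) (z : ℂ) (r : ℝ), IsPos l ∧ l 1 = 1 ∧ 0 < r ∧
      ∀ u : unitary A, r ≤ (z * l ((u : A) * a * star (u : A))).re := by
  obtain ⟨r, z, X, hr, hmax, hz, hXd, hXz, ⟨⟨k, l⟩, hp⟩, hXc, hXu, hXm⟩ := exists_extremal_pairs h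
  obtain ⟨hl, hl1, hk⟩ := hXd hp
  obtain ⟨-, hkr⟩ := hXz _ hp
  simp only at hl hl1 hk hkr
  have hle : ∀ (c : ℂ) (s : ℝ), optVal k l c s ≤ max ((c * z).re - s) 0 := by
    intro c
    have hLip := lipschitzWith_optVal hl hl1 hk c
    have hdense : Dense {s : ℝ | optVal k l c s ≤ max ((c * z).re - s) 0} := by
      refine (MeasureTheory.Measure.dense_of_ae (μ := MeasureTheory.volume)
        (LipschitzWith.ae_differentiableAt_real hLip)).mono fun s hs => ?_
      exact optVal_le_max hmax hz hXd hXz hXc hXu c s (hXm c s) hp hs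
    have hclosed : IsClosed {s : ℝ | optVal k l c s ≤ max ((c * z).re - s) 0} :=
      isClosed_le hLip.continuous (by fun_prop)
    intro s
    have := hclosed.closure_eq ▸ hdense s
    exact this
  have hIcc : ∀ x ∈ Set.Icc (0 : A) 1, k x = z * l x := by
    intro x hx
    have h1 : ∀ c : ℂ, (c * (k x - z * (l x).re)).re ≤ 0 := by
      intro c
      have h2 := (tilt_le_optVal hl hl1 hk c (c * z).re hx).trans (hle c _)
      rw [sub_self, max_self, tilt] at h2
      rw [mul_sub, Complex.sub_re, ← mul_assoc, Complex.re_mul_ofReal]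
      exact h2
    have h2 := h1 (starRingEnd ℂ (k x - z * (l x).re))
    rw [mul_comm, Complex.mul_conj, Complex.ofReal_re] at h2
    have h3 := Complex.normSq_eq_zero.1 (le_antisymm h2 (Complex.normSq_nonneg _))
    rw [hl.eq_re hx.1.isSelfAdjoint]
    exact sub_eq_zero.1 h3
  have hall : ∀ x, k x = z * l x := by
    intro x
    have hx : x ∈ Submodule.span ℂ {x : A | 0 ≤ x} := by
      rw [CStarAlgebra.span_nonneg]; trivial
    induction hx using Submodule.span_induction with
    | mem x hx =>
      rcases eq_or_ne x 0 with rfl | h0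
      · simp
      have hn : 0 < ‖x‖ := norm_pos_iff.2 h0
      have h1 := hIcc (‖x‖⁻¹ • x) ⟨smul_nonneg (by positivity) hx, by
        rw [← CStarAlgebra.norm_le_one_iff_of_nonneg _ (smul_nonneg (by positivity) hx),
          norm_smul, norm_inv, norm_norm, inv_mul_cancel₀ hn.ne']⟩
      simp only [WeakDual.map_real_smul] at h1
      rw [mul_left_comm] at h1
      exact mul_left_cancel₀ (by exact_mod_cast (inv_pos.2 hn).ne') h1
    | zero => simp
    | add x y _ _ hx hy => rw [map_add, map_add, hx, hy, mul_add]
    | smul c x _ hx => rw [map_smul, map_smul, hx, smul_eq_mul, smul_eq_mul, mul_left_comm]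
  exact ⟨l, z, r, hl, hl1, hr, fun u => by rw [← hall]; exact hkr u⟩

end order

/-- Positive functionals of mass `μ` that are at least `r` on all unitary conjugates of `b`. -/
def largeSet (b : A) (r μ : ℝ) : Set (WeakDual ℂ A) :=
  {g | IsPos g ∧ (g 1).re = μ ∧ ∀ u : unitary A, r ≤ (g ((u : A) * b * star (u : A))).re}

lemma isClosed_largeSet (b : A) (r μ : ℝ) : IsClosed (largeSet b r μ) := by
  have hc : ∀ x : A, Continuous fun g : WeakDual ℂ A => (g x).re := fun x =>
    Complex.continuous_re.comp (WeakDual.eval_continuous x)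
  refine IsClosed.inter ?_ (IsClosed.inter (isClosed_eq (hc 1) continuous_const) ?_)
  · change IsClosed {g : WeakDual ℂ A | ∀ x, _}
    rw [Set.ofPred_forall]
    exact isClosed_iInter fun x => isClosed_le continuous_const (WeakDual.eval_continuous _)
  · change IsClosed {g : WeakDual ℂ A | ∀ x, _}
    rw [Set.ofPred_forall]
    exact isClosed_iInter fun u => isClosed_le continuous_const (hc _)

lemma convex_largeSet (b : A) (r μ : ℝ) : Convex ℝ (largeSet b r μ) := by
  rintro f ⟨h1, h2, h3⟩ g ⟨h1', h2', h3'⟩ s t hs ht hst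
  have hre : ∀ x, ((s • f + t • g) x).re = s * (f x).re + t * (g x).re := fun x => by
    simp only [WeakDual.add_apply', WeakDual.real_smul_apply, Complex.add_re, Complex.re_ofReal_mul]
  refine ⟨fun x => ?_, ?_, fun u => ?_⟩
  · simp only [WeakDual.add_apply', WeakDual.real_smul_apply]
    exact add_nonneg (mul_nonneg (by exact_mod_cast hs) (h1 x))
      (mul_nonneg (by exact_mod_cast ht) (h1' x))
  · rw [hre, h2, h2', ← add_mul, hst, one_mul]
  · rw [hre]
    have := mul_le_mul_of_nonneg_left (h3 u) hs
    have := mul_le_mul_of_nonneg_left (h3' u) ht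
    have : r = s * r + t * r := by rw [← add_mul, hst, one_mul]
    linarith

lemma IsSelfAdjoint.sum_unitary_conj {b : A} {w : unitary A} {c : A}
    (hw : (w : A) = b + Complex.I • c)
    (hw' : star (w : A) = b - Complex.I • c) (y : A) :
    (w : A) * y * star (w : A) + star (w : A) * y * w = (2 : ℝ) • (b * y * b + c * y * c) := by
  rw [hw', hw, two_smul]
  simp only [add_mul, mul_add, sub_mul, mul_sub, smul_mul_assoc, mul_smul_comm, smul_smul,
    smul_sub, smul_add, Complex.I_mul_I, neg_smul, one_smul]
  abel

section order

variable [PartialOrder A] [StarOrderedRing A]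

lemma isCompact_largeSet (b : A) (r μ : ℝ) : IsCompact (largeSet b r μ) :=
  (isCompact_setOf_norm_le (2 * μ)).of_isClosed_subset (isClosed_largeSet b r μ)
    fun g ⟨h1, h2, _⟩ x => by
      rw [← h2]
      exact h1.dom_self.norm_apply_le h1 x

lemma adj_mem_largeSet {b : A} {r μ : ℝ} {g : WeakDual ℂ A} (hg : g ∈ largeSet b r μ)
    (u : unitary A) : adj u g ∈ largeSet b r μ := by
  obtain ⟨h1, h2, h3⟩ := hg
  refine ⟨h1.adj u, ?_, fun v => ?_⟩
  · rw [adj_apply, mul_one, Unitary.mul_star_self_of_mem u.2, h2]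
  · have := h3 (u * v)
    simpa [mul_assoc] using this

/-- Removing a maximal tracial part leaves functionals with no tracial part. -/
lemma exists_largeSet_traceless {b : A} {r : ℝ}
    (hτ : ∀ τ : WeakDual ℂ A, IsPos τ → (∀ x y, τ (x * y) = τ (y * x)) → τ b = 0)
    (hne : (largeSet b r 1).Nonempty) :
    ∃ μ ≤ 1, (largeSet b r μ).Nonempty ∧ ∀ g ∈ largeSet b r μ, ∀ τ : WeakDual ℂ A, IsPos τ →
      (∀ x y, τ (x * y) = τ (y * x)) → IsPos (g - τ) → (τ 1).re ≤ 0 := by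
  have hc1 : ∀ x : A, Continuous fun p : WeakDual ℂ A × WeakDual ℂ A => p.1 x := fun x =>
    (WeakDual.eval_continuous x).comp continuous_fst
  have hc2 : ∀ x : A, Continuous fun p : WeakDual ℂ A × WeakDual ℂ A => p.2 x := fun x =>
    (WeakDual.eval_continuous x).comp continuous_snd
  set S : Set (WeakDual ℂ A × WeakDual ℂ A) := {p | p.1 ∈ largeSet b r 1 ∧ IsPos p.2 ∧
    (∀ q : A × A, p.2 (q.1 * q.2) = p.2 (q.2 * q.1)) ∧
      ∀ x : A, 0 ≤ p.1 (star x * x) - p.2 (star x * x)} with hS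
  have hScl : IsClosed S := by
    refine ((isClosed_largeSet b r 1).preimage continuous_fst).inter
      ((isClosed_isPos.preimage continuous_snd).inter (IsClosed.inter ?_ ?_))
    · change IsClosed {p : WeakDual ℂ A × WeakDual ℂ A | ∀ x, _}
      rw [Set.ofPred_forall]
      exact isClosed_iInter fun x => isClosed_eq (hc2 _) (hc2 _)
    · change IsClosed {p : WeakDual ℂ A × WeakDual ℂ A | ∀ x, _}
      rw [Set.ofPred_forall]
      exact isClosed_iInter fun x => isClosed_le continuous_const ((hc1 _).sub (hc2 _))
  have hle : ∀ p ∈ S, (p.2 1).re ≤ 1 := by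
    rintro ⟨g, τ⟩ ⟨⟨-, h1, -⟩, -, -, h4⟩
    have := h4 1
    rw [star_one, mul_one, Complex.nonneg_iff, Complex.sub_re] at this
    simp only at h1 this ⊢
    linarith
  have hScpt : IsCompact S := by
    refine ((isCompact_largeSet b r 1).prod (isCompact_setOf_norm_le 2)).of_isClosed_subset hScl ?_
    rintro p hp
    refine ⟨hp.1, fun x => (hp.2.1.dom_self.norm_apply_le hp.2.1 x).trans ?_⟩
    have := hle p hp
    gcongr
    linarith
  obtain ⟨g₀, hg₀⟩ := hne
  have hSne : S.Nonempty := ⟨(g₀, 0), hg₀, fun x => by simp, fun q => by simp, fun x => by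
    simpa using hg₀.1 x⟩
  obtain ⟨⟨g, τ⟩, ⟨hg, hτp, hτt, hgτ⟩, hmax⟩ := hScpt.exists_isMaxOn hSne
    (f := fun p => (p.2 1).re) (Complex.continuous_re.comp (hc2 1)).continuousOn
  simp only at hg hτp hτt hgτ
  have hτu : ∀ u : unitary A, τ ((u : A) * b * star (u : A)) = 0 := fun u => by
    rw [hτt (_, _), ← mul_assoc, Unitary.star_mul_self_of_mem u.2, one_mul]
    exact hτ τ hτp (fun x y => hτt (x, y))
  refine ⟨1 - (τ 1).re, by linarith [hτp.re_nonneg (zero_le_one (α := A))],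
    ⟨g - τ, hgτ, ?_, fun u => ?_⟩, ?_⟩
  · rw [WeakDual.sub_apply', Complex.sub_re, hg.2.1]
  · rw [WeakDual.sub_apply', hτu, sub_zero]
    exact hg.2.2 u
  · rintro g' ⟨h1, h2, h3⟩ τ' hτ'p hτ't hg'
    have hmem : (g' + τ, τ' + τ) ∈ S := by
      refine ⟨⟨fun x => ?_, ?_, fun u => ?_⟩, fun x => ?_, fun q => ?_, fun x => ?_⟩
      · exact add_nonneg (h1 x) (hτp x)
      · simp [h2]
      · simpa [hτu] using h3 u
      · exact add_nonneg (hτ'p x) (hτp x)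
      · simp only [WeakDual.add_apply']
        rw [hτ't, hτt (_, _)]
      · have := hg' x
        simpa using this
    have := hmax hmem
    simp only [Set.mem_ofPred_eq, WeakDual.add_apply', Complex.add_re] at this
    linarith

/-- A functional maximising `e` over the unitarily invariant convex set `largeSet` satisfies a
one-sided trace inequality on elements `x` with `e x = x` and `x e = 0`. -/
lemma re_star_mul_self_le_of_isMaxOn {b e : A} {r μ : ℝ} {g : WeakDual ℂ A}
    (hg : g ∈ largeSet b r μ) (hmax : ∀ f ∈ largeSet b r μ, (f e).re ≤ (g e).re)
    (he : IsSelfAdjoint e) {x : A} (hex : e * x = x) (hxe : x * e = 0) :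
    (g (star x * x)).re ≤ (g (x * star x)).re := by
  have key : ∀ x : A, e * x = x → x * e = 0 → ‖x + star x‖ ≤ 1 →
      (g (star x * x)).re ≤ (g (x * star x)).re := by
    intro x hex hxe hn
    have hse : star x * e = star x := by simpa [he.star_eq] using congrArg star hex
    have hes : e * star x = 0 := by simpa [he.star_eq] using congrArg star hxe
    have hxx : x * x = 0 := by
      calc x * x = x * (e * x) := by rw [hex]
        _ = 0 := by rw [← mul_assoc, hxe, zero_mul]
    have hss : star x * star x = 0 := by simpa using congrArg star hxx
    set β := x + star x with hβ
    have hβs : IsSelfAdjoint β := IsSelfAdjoint.add_star_self x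
    obtain ⟨w, hw, hw'⟩ := exists_unitary_of_selfAdjoint hβs hn
    set c := CFC.sqrt (1 - β ^ 2) with hc
    have hβ2 : β ^ 2 = x * star x + star x * x := by
      rw [sq, hβ, add_mul, mul_add, mul_add, hxx, hss]; abel
    have hβn : 0 ≤ 1 - β ^ 2 := by
      rw [sub_nonneg, ← CStarAlgebra.norm_le_one_iff_of_nonneg _ hβs.sq_nonneg]
      exact (norm_pow_le' β (by norm_num)).trans (pow_le_one₀ (norm_nonneg _) hn)
    have hcc : c * c = 1 - β ^ 2 := CFC.sqrt_mul_sqrt_self _ hβn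
    have hce : Commute e c := by
      have h1 : Commute e (1 - β ^ 2) := by
        refine (Commute.one_right e).sub_right ?_
        rw [Commute, SemiconjBy, hβ2, mul_add, add_mul, ← mul_assoc, hex, mul_assoc x, hse,
          ← mul_assoc e, hes, mul_assoc (star x), hxe, zero_mul, mul_zero]
      rw [hc, CFC.sqrt_eq_cfc]
      exact (h1.symm.cfc_nnreal _).symm
    have h1 := IsSelfAdjoint.sum_unitary_conj hw hw' e
    have h2 : β * e * β + c * e * c = e + star x * x - x * star x := by
      rw [← hce.eq, mul_assoc e c c, hcc, hβ2]
      simp only [hβ, add_mul, mul_add, mul_sub, hxe, hse, mul_one, ← mul_assoc, hex, hes, zero_mul,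
        hss]
      abel
    have hm1 := adj_mem_largeSet hg w
    have hm2 := adj_mem_largeSet hg (star w)
    have h3 := hmax _ hm1
    have h4 := hmax _ hm2
    rw [adj_apply] at h3 h4
    simp only [Unitary.coe_star, star_star] at h4
    rw [h2] at h1
    have h5 := congrArg (fun y => (g y).re) h1
    simp only [map_add, map_sub, Complex.add_re, Complex.sub_re, WeakDual.map_real_smul,
      Complex.re_ofReal_mul] at h5
    linarith
  set t : ℝ := (‖x + star x‖ + 1)⁻¹ with ht
  have ht0 : 0 < t := by positivity
  have h1 := key (t • x) (by rw [mul_smul_comm, hex]) (by rw [smul_mul_assoc, hxe, smul_zero]) (by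
    rw [star_smul, star_trivial, ← smul_add, norm_smul, Real.norm_of_nonneg ht0.le, ht,
      inv_mul_le_iff₀ (by positivity)]
    linarith)
  simp only [star_smul, star_trivial, smul_mul_assoc, mul_smul_comm, smul_smul,
    WeakDual.map_real_smul, Complex.re_ofReal_mul] at h1
  exact le_of_mul_le_mul_left h1 (by positivity)

end order

/-- The sum of the `y* y` over a list. -/
def gram (S : List A) : A := (S.map fun y => star y * y).sum

/-- The sum of the `φ (y y*)` over a list. -/
def cogram (φ : WeakDual ℂ A) (S : List A) : ℝ := (S.map fun y => (φ (y * star y)).re).sum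

@[simp] lemma gram_nil : gram ([] : List A) = 0 := rfl
@[simp] lemma gram_cons (y : A) (S : List A) : gram (y :: S) = star y * y + gram S := rfl
@[simp] lemma cogram_nil (φ : WeakDual ℂ A) : cogram φ [] = 0 := rfl
@[simp] lemma cogram_cons (φ : WeakDual ℂ A) (y : A) (S : List A) :
    cogram φ (y :: S) = (φ (y * star y)).re + cogram φ S := rfl

lemma gram_append (S T : List A) : gram (S ++ T) = gram S + gram T := by simp [gram]

lemma cogram_append (φ : WeakDual ℂ A) (S T : List A) :
    cogram φ (S ++ T) = cogram φ S + cogram φ T := by simp [cogram]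

lemma gram_map_mul (S : List A) (d : A) : gram (S.map (· * d)) = star d * gram S * d := by
  induction S with
  | nil => simp
  | cons y S ih => simp [ih, mul_add, add_mul, mul_assoc]

lemma cogram_map_mul_unitary (φ : WeakDual ℂ A) (S : List A) (u : unitary A) :
    cogram φ (S.map (· * (u : A))) = cogram φ S := by
  induction S with
  | nil => simp
  | cons y S ih =>
    have : y * u * star (y * (u : A)) = y * star y := by
      rw [star_mul, mul_assoc, ← mul_assoc (u : A), Unitary.mul_star_self_of_mem u.2, one_mul]
    rw [List.map_cons, cogram_cons, cogram_cons, ih, this]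

lemma cogram_map_mul_smul (φ : WeakDual ℂ A) (S : List A) (t : ℝ) :
    cogram φ (S.map (· * (t • (1 : A)))) = t ^ 2 * cogram φ S := by
  induction S with
  | nil => simp
  | cons y S ih =>
    rw [List.map_cons, cogram_cons, cogram_cons, ih]
    simp only [mul_smul_comm, smul_mul_assoc, mul_one, star_smul, star_trivial, smul_smul,
      WeakDual.map_real_smul, Complex.re_ofReal_mul]
    ring

section partialOrder

variable [PartialOrder A]

/-- `M` bounds all `cogram φ S` with `gram S ≤ c`. -/
def GramBound (φ : WeakDual ℂ A) (c : A) (M : ℝ) : Prop := ∀ S : List A, gram S ≤ c → cogram φ S ≤ M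

lemma GramBound.mono {φ : WeakDual ℂ A} {c c' : A} {M : ℝ} (h : GramBound φ c M)
    (hc : c' ≤ c) : GramBound φ c' M :=
  fun S hS => h S (hS.trans hc)

end partialOrder

section order

variable [PartialOrder A] [StarOrderedRing A]

lemma gram_nonneg (S : List A) : 0 ≤ gram S := by
  induction S with
  | nil => simp
  | cons y S ih => exact add_nonneg (star_mul_self_nonneg y) ih

lemma star_mul_self_le_gram {S : List A} {y : A} (hy : y ∈ S) : star y * y ≤ gram S := by
  induction S with
  | nil => simp at hy
  | cons z S ih =>
    rw [gram_cons]
    rcases List.mem_cons.1 hy with rfl | h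
    · exact le_add_of_nonneg_right (gram_nonneg S)
    · exact (ih h).trans (le_add_of_nonneg_left (star_mul_self_nonneg z))

/-- Riesz decomposition for lists. -/
lemma exists_gram_le_of_gram_le_add {φ : WeakDual ℂ A} (hφ : IsPos φ) {S : List A} {c₁ c₂ : A}
    (h₁ : 0 ≤ c₁) (h₂ : 0 ≤ c₂) (hS : gram S ≤ c₁ + c₂) {δ : ℝ} (hδ : 0 < δ) :
    ∃ S₁ S₂ : List A, gram S₁ ≤ c₁ ∧ gram S₂ ≤ c₂ ∧
      cogram φ S ≤ cogram φ S₁ + cogram φ S₂ + δ * (S.length * (2 * (φ 1).re)) := by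
  obtain ⟨P, R, hPs, hRs, hPP, hPR, hRP⟩ : ∃ P R : A, star P = P ∧ star R = R ∧
      P * P = c₁ + c₂ + δ • 1 ∧ P * R = 1 ∧ R * P = 1 := by
    have h0 : (0 : A) ≤ δ • 1 := smul_nonneg hδ.le zero_le_one
    have h3 : 0 ≤ c₁ + c₂ + δ • (1 : A) := add_nonneg (add_nonneg h₁ h₂) h0
    have hu : IsUnit (c₁ + c₂ + δ • (1 : A)) := by
      refine CStarAlgebra.isUnit_of_le (δ • (1 : A)) (le_add_of_nonneg_left (add_nonneg h₁ h₂)) ?_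
      refine ⟨h0, ?_⟩
      rw [← Algebra.algebraMap_eq_smul_one]
      exact (IsUnit.mk0 δ hδ.ne').map (algebraMap ℝ A)
    have hsq : CFC.sqrt (c₁ + c₂ + δ • (1 : A)) * CFC.sqrt (c₁ + c₂ + δ • (1 : A)) =
      c₁ + c₂ + δ • (1 : A) := CFC.sqrt_mul_sqrt_self _ h3
    obtain ⟨v, hv⟩ := (CFC.isUnit_sqrt_iff _ h3).2 hu
    have hvs : star (v : A) = v := by
      rw [hv]; exact (CFC.sqrt_nonneg _).isSelfAdjoint.star_eq
    refine ⟨v, (v⁻¹ : Aˣ), hvs, ?_, by rw [hv, hsq], v.mul_inv, v.inv_mul⟩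
    have : star v = v := Units.ext hvs
    rw [← Units.coe_star_inv, this]
  set Z := S.map (· * R) with hZ
  have hZ1 : gram Z ≤ 1 := by
    rw [hZ, gram_map_mul, hRs]
    have h1 : gram S ≤ P * P := hS.trans (by
      rw [hPP]; exact le_add_of_nonneg_right (smul_nonneg hδ.le zero_le_one))
    have := star_left_conjugate_le_conjugate h1 R
    rwa [hRs, ← mul_assoc R P P, hRP, one_mul, hPR] at this
  have hw : ∀ c : A, 0 ≤ c → gram (Z.map (· * CFC.sqrt c)) ≤ c := by
    intro c hc
    rw [gram_map_mul, (CFC.sqrt_nonneg c).isSelfAdjoint.star_eq]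
    have := star_left_conjugate_le_conjugate hZ1 (CFC.sqrt c)
    rwa [mul_one, (CFC.sqrt_nonneg c).isSelfAdjoint.star_eq, CFC.sqrt_mul_sqrt_self c hc] at this
  refine ⟨_, _, hw c₁ h₁, hw c₂ h₂, ?_⟩
  have key : ∀ T : List A, gram (T.map (· * R)) ≤ 1 → cogram φ T ≤
      cogram φ ((T.map (· * R)).map (· * CFC.sqrt c₁)) +
        cogram φ ((T.map (· * R)).map (· * CFC.sqrt c₂)) + δ * (T.length * (2 * (φ 1).re)) := by
    intro T
    induction T with
    | nil => intro _; simp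
    | cons y T ih =>
      intro hT
      simp only [List.map_cons, gram_cons] at hT
      have h1 := ih ((le_add_of_nonneg_left (star_mul_self_nonneg _)).trans hT)
      have h2 : star (y * R) * (y * R) ≤ 1 :=
        (le_add_of_nonneg_right (gram_nonneg _)).trans hT
      simp only [List.map_cons, cogram_cons, List.length_cons]
      have h3 : (φ (y * star y)).re = (φ (y * R * CFC.sqrt c₁ * star (y * R * CFC.sqrt c₁))).re +
          (φ (y * R * CFC.sqrt c₂ * star (y * R * CFC.sqrt c₂))).re +
          δ * (φ (y * R * star (y * R))).re := by
        rw [← Complex.re_ofReal_mul, ← WeakDual.map_real_smul, ← Complex.add_re, ← Complex.add_re,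
          ← map_add, ← map_add]
        congr 2
        have e1 : ∀ c : A, 0 ≤ c → y * R * CFC.sqrt c * star (y * R * CFC.sqrt c) =
            y * R * c * star (y * R) := by
          intro c hc
          rw [star_mul (y * R), (CFC.sqrt_nonneg c).isSelfAdjoint.star_eq, mul_assoc (y * R),
            ← mul_assoc (CFC.sqrt c), CFC.sqrt_mul_sqrt_self c hc, ← mul_assoc]
        rw [e1 c₁ h₁, e1 c₂ h₂]
        have e2 : y * R * c₁ * star (y * R) + y * R * c₂ * star (y * R) +
            δ • (y * R * star (y * R)) = y * R * (c₁ + c₂ + δ • 1) * star (y * R) := by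
          simp only [mul_add, add_mul, mul_smul_comm, smul_mul_assoc, mul_one]
        rw [e2, ← hPP, star_mul, hRs]
        simp only [mul_assoc]
        rw [← mul_assoc P R, hPR, one_mul, ← mul_assoc R P, hRP, one_mul]
      have h4 : (φ (y * R * star (y * R))).re ≤ 2 * (φ 1).re := by
        refine (Complex.re_le_norm _).trans ((hφ.dom_self.norm_apply_le hφ _).trans ?_)
        rw [CStarRing.norm_self_mul_star, ← CStarRing.norm_star_mul_self]
        have := (CStarAlgebra.norm_le_one_iff_of_nonneg _ (star_mul_self_nonneg (y * R))).2 h2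
        have := hφ.re_nonneg (zero_le_one (α := A))
        nlinarith
      push_cast
      nlinarith
  exact key S hZ1

namespace GramBound

variable {φ : WeakDual ℂ A}

lemma add (hφ : IsPos φ) {c₁ c₂ : A} {M₁ M₂ : ℝ} (h₁ : 0 ≤ c₁) (h₂ : 0 ≤ c₂)
    (hM₁ : GramBound φ c₁ M₁) (hM₂ : GramBound φ c₂ M₂) : GramBound φ (c₁ + c₂) (M₁ + M₂) := by
  intro S hS
  have h0 : 0 ≤ (S.length : ℝ) * (2 * (φ 1).re) := by
    have := hφ.re_nonneg (zero_le_one (α := A))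
    positivity
  refine le_of_forall_pos_le_add fun ε hε => ?_
  obtain ⟨S₁, S₂, hS₁, hS₂, hle⟩ := exists_gram_le_of_gram_le_add hφ h₁ h₂ hS
    (δ := ε / (S.length * (2 * (φ 1).re) + 1)) (by positivity)
  have h3 : ε / (S.length * (2 * (φ 1).re) + 1) * (S.length * (2 * (φ 1).re)) ≤ ε := by
    rw [div_mul_eq_mul_div, div_le_iff₀ (by positivity)]
    nlinarith
  have := hM₁ S₁ hS₁
  have := hM₂ S₂ hS₂
  linarith

lemma conj {c : A} {M : ℝ} (h : GramBound φ c M) (u : unitary A) :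
    GramBound φ ((u : A) * c * star (u : A)) M := by
  intro S hS
  rw [← cogram_map_mul_unitary φ S u]
  refine h _ ?_
  rw [gram_map_mul]
  have := star_left_conjugate_le_conjugate hS (u : A)
  refine this.trans_eq ?_
  have huu := Unitary.star_mul_self_of_mem u.2
  rw [mul_assoc, mul_assoc, huu, mul_one, ← mul_assoc, huu, one_mul]

lemma smul {c : A} {M t : ℝ} (ht : 0 < t) (h : GramBound φ c M) :
    GramBound φ (t • c) (t * M) := by
  intro S hS
  have h1 := h (S.map (· * ((√t)⁻¹ • (1 : A)))) (by
    rw [gram_map_mul]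
    have h2 := smul_le_smul_of_nonneg_left hS (inv_nonneg.2 ht.le)
    rw [inv_smul_smul₀ ht.ne'] at h2
    refine le_trans (le_of_eq ?_) h2
    simp only [star_smul, star_trivial, star_one, smul_mul_assoc, mul_smul_comm, one_mul, mul_one,
      smul_smul]
    rw [← mul_inv, Real.mul_self_sqrt ht.le])
  rw [cogram_map_mul_smul, inv_pow, Real.sq_sqrt ht.le, inv_mul_le_iff₀ ht] at h1
  exact h1

end GramBound

lemma cogram_eq_zero_of_gram_le_zero (φ : WeakDual ℂ A) {S : List A} (h : gram S ≤ 0) :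
    cogram φ S = 0 := by
  induction S with
  | nil => rfl
  | cons y S ih =>
    have hy : star y * y = 0 := le_antisymm
      ((star_mul_self_le_gram (List.mem_cons_self)).trans h) (star_mul_self_nonneg y)
    rw [gram_cons, hy, zero_add] at h
    rw [cogram_cons, ih h, (CStarRing.star_mul_self_eq_zero_iff _).1 hy]
    simp

/-- An additive, positively homogeneous, nonnegative function on the positive cone extends to a
positive functional. -/
lemma exists_isPos_of_additive {m : A → ℝ} (hadd : ∀ c d, 0 ≤ c → 0 ≤ d → m (c + d) = m c + m d)
    (hsmul : ∀ (t : ℝ) c, 0 ≤ t → 0 ≤ c → m (t • c) = t * m c) (hnn : ∀ c, 0 ≤ c → 0 ≤ m c) :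
    ∃ f : WeakDual ℂ A, IsPos f ∧ ∀ c, 0 ≤ c → (f c).re = m c := by
  set R : A → A := fun x => (1 / 2 : ℝ) • (x + star x) with hR
  have hRs : ∀ x, IsSelfAdjoint (R x) := fun x => by
    rw [IsSelfAdjoint, hR, star_smul, star_trivial, star_add, star_star, add_comm]
  have hn : ∀ x : A, 0 ≤ ‖x‖ • (1 : A) := fun x => smul_nonneg (norm_nonneg _) zero_le_one
  have hpos : ∀ x, 0 ≤ R x + ‖R x‖ • (1 : A) := fun x => by
    have := (hRs x).neg_algebraMap_norm_le_self
    rw [Algebra.algebraMap_eq_smul_one, neg_le_iff_add_nonneg] at this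
    exact this
  set φ : A → ℝ := fun x => m (R x + ‖R x‖ • (1 : A)) - m (‖R x‖ • (1 : A)) with hφ
  have hφR : ∀ x c d, 0 ≤ c → 0 ≤ d → R x = c - d → φ x = m c - m d := by
    intro x c d hc hd h
    have h1 := hadd _ _ (hpos x) hd
    have h2 := hadd _ _ hc (hn (R x))
    have h3 : R x + ‖R x‖ • (1 : A) + d = c + ‖R x‖ • (1 : A) := by
      rw [add_right_comm]; congr 1; rw [h, sub_add_cancel]
    rw [h3] at h1
    simp only [hφ]
    linarith
  have hdec : ∀ x, ∃ c d, 0 ≤ c ∧ 0 ≤ d ∧ R x = c - d := fun x =>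
    ⟨_, _, hpos x, hn (R x), by rw [add_sub_cancel_right]⟩
  have hφadd : ∀ x y, φ (x + y) = φ x + φ y := by
    intro x y
    obtain ⟨c, d, hc, hd, h⟩ := hdec x
    obtain ⟨c', d', hc', hd', h'⟩ := hdec y
    have hRR : R (x + y) = (c + c') - (d + d') := by
      have : R (x + y) = R x + R y := by
        simp only [hR, star_add]
        rw [← smul_add]; congr 1; abel
      rw [this, h, h']; abel
    rw [hφR _ _ _ hc hd h, hφR _ _ _ hc' hd' h',
      hφR _ _ _ (add_nonneg hc hc') (add_nonneg hd hd') hRR, hadd _ _ hc hc', hadd _ _ hd hd']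
    ring
  have hφsmul : ∀ (t : ℝ) x, φ (t • x) = t * φ x := by
    intro t x
    obtain ⟨c, d, hc, hd, h⟩ := hdec x
    have hRt : R (t • x) = t • R x := by
      simp only [hR, star_smul, star_trivial, ← smul_add]
      rw [smul_comm]
    rcases le_total 0 t with ht | ht
    · have hRR : R (t • x) = t • c - t • d := by rw [hRt, h, smul_sub]
      rw [hφR _ _ _ hc hd h, hφR _ _ _ (smul_nonneg ht hc) (smul_nonneg ht hd) hRR,
        hsmul _ _ ht hc, hsmul _ _ ht hd]
      ring
    · have ht' : 0 ≤ -t := neg_nonneg.2 ht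
      have hRR : R (t • x) = (-t) • d - (-t) • c := by
        rw [hRt, h, smul_sub, neg_smul, neg_smul]; abel
      rw [hφR _ _ _ hc hd h, hφR _ _ _ (smul_nonneg ht' hd) (smul_nonneg ht' hc) hRR,
        hsmul _ _ ht' hc, hsmul _ _ ht' hd]
      ring
  have hm0 : m 0 = 0 := by simpa using hsmul 0 0 le_rfl le_rfl
  have hφc : ∀ c, 0 ≤ c → φ c = m c := by
    intro c hc
    rw [hφR c c 0 hc le_rfl, hm0, sub_zero]
    simp only [hR, hc.isSelfAdjoint.star_eq, sub_zero]
    rw [← two_smul ℝ c, smul_smul]; norm_num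
  obtain ⟨f, hf, hfφ⟩ := exists_isPos_of_real (IsLinearMap.mk' φ ⟨hφadd, hφsmul⟩)
    (fun x hx => by rw [IsLinearMap.mk'_apply, hφc x hx]; exact hnn x hx)
    (fun x hx => by
      rw [IsLinearMap.mk'_apply, hφR x 0 0 le_rfl le_rfl, sub_self]
      simp only [hR, hx, add_neg_cancel, smul_zero, sub_zero])
  exact ⟨f, hf, fun c hc => by rw [hfφ, IsLinearMap.mk'_apply, hφc c hc]⟩

lemma trace_of_forall_conj {f : WeakDual ℂ A} (hf : IsPos f)
    (h : ∀ (u : unitary A) c, 0 ≤ c → (f ((u : A) * c * star (u : A))).re = (f c).re) (x y : A) :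
    f (x * y) = f (y * x) := by
  have h1 : ∀ (u : unitary A) c, f ((u : A) * c * star (u : A)) = f c := by
    intro u c
    have hc : c ∈ Submodule.span ℂ {x : A | 0 ≤ x} := by
      rw [CStarAlgebra.span_nonneg]; trivial
    induction hc using Submodule.span_induction with
    | mem c hc =>
      rw [hf.eq_re (IsSelfAdjoint.of_nonneg hc),
        hf.eq_re (IsSelfAdjoint.of_nonneg (star_right_conjugate_nonneg hc _)), h u c hc]
    | zero => simp
    | add x y _ _ hx hy => rw [mul_add, add_mul, map_add, map_add, hx, hy]
    | smul t x _ hx => rw [mul_smul_comm, smul_mul_assoc, map_smul, map_smul, hx]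
  have hy : y ∈ Submodule.span ℂ (unitary A : Set A) := by
    rw [CStarAlgebra.span_unitary]; trivial
  induction hy using Submodule.span_induction with
  | mem u hu =>
    have := h1 ⟨u, hu⟩ (x * u)
    simp only at this
    rw [← this, mul_assoc, mul_assoc x, Unitary.mul_star_self_of_mem hu, mul_one]
  | zero => simp
  | add x y _ _ hx hy => rw [mul_add, add_mul, map_add, map_add, hx, hy]
  | smul t x _ hx => rw [mul_smul_comm, smul_mul_assoc, map_smul, map_smul, hx]

/-- The tracial functional generated by `φ`, when it is finite. -/
lemma exists_trace_of_gramBound {φ : WeakDual ℂ A} (hφ : IsPos φ)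
    (hfin : ∀ c : A, 0 ≤ c → ∃ M, GramBound φ c M) :
    ∃ τ : WeakDual ℂ A, IsPos τ ∧ (∀ x y, τ (x * y) = τ (y * x)) ∧ (φ 1).re ≤ (τ 1).re ∧
      ∀ c M, 0 ≤ c → GramBound φ c M → (τ c).re ≤ M := by
  set m : A → ℝ := fun c => sSup (cogram φ '' {S | gram S ≤ c}) with hm
  have hle : ∀ c S, 0 ≤ c → gram S ≤ c → cogram φ S ≤ m c := by
    intro c S hc hS
    obtain ⟨M, hM⟩ := hfin c hc
    refine le_csSup ⟨M, ?_⟩ ⟨S, hS, rfl⟩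
    rintro _ ⟨T, hT, rfl⟩
    exact hM T hT
  have hmM : ∀ c M, 0 ≤ c → GramBound φ c M → m c ≤ M := by
    intro c M hc hM
    refine csSup_le ⟨_, [], by simpa using hc, rfl⟩ ?_
    rintro _ ⟨T, hT, rfl⟩
    exact hM T hT
  have hmb : ∀ c, 0 ≤ c → GramBound φ c (m c) := fun c hc S hS => hle c S hc hS
  have hnn : ∀ c, 0 ≤ c → 0 ≤ m c := fun c hc => hle c [] hc (by simpa using hc)
  have hadd : ∀ c d, 0 ≤ c → 0 ≤ d → m (c + d) = m c + m d := by
    intro c d hc hd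
    refine le_antisymm (hmM _ _ (add_nonneg hc hd) ((hmb c hc).add hφ hc hd (hmb d hd))) ?_
    have h1 : GramBound φ c (m (c + d) - m d) := by
      intro S hS
      have : GramBound φ d (m (c + d) - cogram φ S) := by
        intro T hT
        have := hle (c + d) (S ++ T) (add_nonneg hc hd) (by
          rw [gram_append]; exact add_le_add hS hT)
        rw [cogram_append] at this
        linarith
      have := hmM _ _ hd this
      linarith
    have := hmM _ _ hc h1
    linarith
  have hm0 : m 0 = 0 := by
    refine le_antisymm (hmM _ _ le_rfl fun S hS => ?_) (hnn 0 le_rfl)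
    rw [cogram_eq_zero_of_gram_le_zero φ hS]
  have hsm : ∀ (t : ℝ) c, 0 < t → 0 ≤ c → m (t • c) ≤ t * m c := fun t c ht hc =>
    hmM _ _ (smul_nonneg ht.le hc) ((hmb c hc).smul ht)
  have hsmul : ∀ (t : ℝ) c, 0 ≤ t → 0 ≤ c → m (t • c) = t * m c := by
    intro t c ht hc
    rcases ht.eq_or_lt with rfl | ht
    · rw [zero_smul, zero_mul, hm0]
    refine le_antisymm (hsm t c ht hc) ?_
    have := hsm t⁻¹ (t • c) (inv_pos.2 ht) (smul_nonneg ht.le hc)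
    rwa [inv_smul_smul₀ ht.ne', ← div_eq_inv_mul, le_div_iff₀ ht, mul_comm] at this
  obtain ⟨τ, hτ, hτm⟩ := exists_isPos_of_additive hadd hsmul hnn
  have hcj : ∀ (u : unitary A) c, 0 ≤ c → m ((u : A) * c * star (u : A)) ≤ m c := fun u c hc =>
    hmM _ _ (star_right_conjugate_nonneg hc _) ((hmb c hc).conj u)
  refine ⟨τ, hτ, trace_of_forall_conj hτ fun u c hc => ?_, ?_, fun c M hc hM => ?_⟩
  · have h0 := star_right_conjugate_nonneg hc (u : A)
    rw [hτm _ hc, hτm _ h0]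
    refine le_antisymm (hcj u c hc) ?_
    have h1 := hcj (star u) _ h0
    have h2 : star (u : A) * (u * c * star (u : A)) * u = c := by
      have huu := Unitary.star_mul_self_of_mem u.2
      rw [mul_assoc, mul_assoc, huu, mul_one, ← mul_assoc, huu, one_mul]
    rwa [Unitary.coe_star, star_star, h2] at h1
  · rw [hτm _ zero_le_one]
    have := hle 1 [1] zero_le_one (by simp)
    simpa using this
  · rw [hτm _ hc]
    exact hmM _ _ hc hM

end order

/-- The convex cone generated by the unitary conjugates of `h`. -/
inductive InConjCone (h : A) : A → Prop
  | zero : InConjCone h 0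
  | conj (u : unitary A) : InConjCone h ((u : A) * h * star (u : A))
  | add {x y : A} : InConjCone h x → InConjCone h y → InConjCone h (x + y)
  | smul {t : ℝ} {x : A} : 0 < t → InConjCone h x → InConjCone h (t • x)

section order

variable [PartialOrder A] [StarOrderedRing A]

lemma IsSelfAdjoint.conj_nonneg {s x : A} (hs : IsSelfAdjoint s) (hx : 0 ≤ x) : 0 ≤ s * x * s := by
  simpa [hs.star_eq] using star_right_conjugate_nonneg hx s

lemma GramBound.of_isMaxOn {b e q c : A} {r μ : ℝ} {g : WeakDual ℂ A}
    (hg : g ∈ largeSet b r μ) (hmax : ∀ f ∈ largeSet b r μ, (f e).re ≤ (g e).re)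
    (he : IsSelfAdjoint e) (hq : IsSelfAdjoint q) (hqe : q * e = 0) (hce : c * (1 - e) = 0) :
    GramBound (sandwich q q g) c (‖q‖ ^ 2 * (g c).re) := by
  have he1 : star (1 - e) = 1 - e := by rw [star_sub, star_one, he.star_eq]
  have key : ∀ y : A, star y * y ≤ c →
      (sandwich q q g (y * star y)).re ≤ ‖q‖ ^ 2 * (g (star y * y)).re := by
    intro y hy
    have h1 : y * (1 - e) = 0 := by
      rw [← CStarRing.star_mul_self_eq_zero_iff]
      refine le_antisymm ?_ (star_mul_self_nonneg _)
      have := star_left_conjugate_le_conjugate hy (1 - e)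
      rw [he1, mul_assoc _ c, hce, mul_zero] at this
      simpa [he1, mul_assoc] using this
    have hye : y * e = y := by rw [mul_sub, mul_one, sub_eq_zero] at h1; exact h1.symm
    have hey : e * star y = star y := by simpa [he.star_eq] using congrArg star hye
    have h2 := re_star_mul_self_le_of_isMaxOn hg hmax he (x := star y * q)
      (by rw [← mul_assoc, hey]) (by rw [mul_assoc, hqe, mul_zero])
    have h3 : star y * (q * q) * y ≤ (‖q‖ ^ 2 : ℝ) • (star y * y) := by
      have := CStarAlgebra.star_left_conjugate_le_norm_smul (a := y) (b := star q * q)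
        (IsSelfAdjoint.star_mul_self q)
      rwa [CStarRing.norm_star_mul_self, ← sq, hq.star_eq] at this
    have h4 := hg.1.mono h3
    rw [WeakDual.map_real_smul, Complex.re_ofReal_mul] at h4
    refine le_trans ?_ h4
    simpa [mul_assoc, hq.star_eq, sandwich_apply] using h2
  have main : ∀ S : List A, gram S ≤ c →
      cogram (sandwich q q g) S ≤ ‖q‖ ^ 2 * (g (gram S)).re := by
    intro S
    induction S with
    | nil => intro _; simp
    | cons y S ih =>
      intro hS
      rw [gram_cons] at hS
      have h1 := ih ((le_add_of_nonneg_left (star_mul_self_nonneg y)).trans hS)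
      have h2 := key y ((le_add_of_nonneg_right (gram_nonneg S)).trans hS)
      rw [gram_cons, cogram_cons, map_add, Complex.add_re, mul_add]
      exact add_le_add h2 h1
  intro S hS
  exact (main S hS).trans (mul_le_mul_of_nonneg_left (hg.1.mono hS) (by positivity))

namespace InConjCone

lemma nonneg {h z : A} (hz : InConjCone h z) (hh : 0 ≤ h) : 0 ≤ z := by
  induction hz with
  | zero => exact le_rfl
  | conj u => exact star_right_conjugate_nonneg hh _
  | add _ _ h1 h2 => exact add_nonneg h1 h2
  | smul ht _ h1 => exact smul_nonneg ht.le h1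

lemma exists_gramBound {h z : A} (hz : InConjCone h z) (hh : 0 ≤ h) {φ : WeakDual ℂ A}
    (hφ : IsPos φ) {M : ℝ} (hM : GramBound φ h M) : ∃ M', GramBound φ z M' := by
  induction hz with
  | zero => exact ⟨0, fun S hS => (cogram_eq_zero_of_gram_le_zero φ hS).le⟩
  | conj u => exact ⟨M, hM.conj u⟩
  | add h1 h2 ih1 ih2 =>
    obtain ⟨M₁, hM₁⟩ := ih1
    obtain ⟨M₂, hM₂⟩ := ih2
    exact ⟨_, hM₁.add hφ (h1.nonneg hh) (h2.nonneg hh) hM₂⟩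
  | smul ht _ ih =>
    obtain ⟨M₁, hM₁⟩ := ih
    exact ⟨_, hM₁.smul ht⟩

lemma exists_gramBound_of_nonneg {h z : A} (hz : InConjCone h z) (hh : 0 ≤ h) (hz1 : 1 ≤ z)
    {φ : WeakDual ℂ A} (hφ : IsPos φ) {M : ℝ} (hM : GramBound φ h M) (c : A) (hc : 0 ≤ c) :
    ∃ M', GramBound φ c M' := by
  obtain ⟨M', hM'⟩ := hz.exists_gramBound hh hφ hM
  refine ⟨_, (hM'.smul (t := ‖c‖ + 1) (by positivity)).mono ?_⟩
  have h1 : c ≤ ‖c‖ • (1 : A) := by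
    simpa [Algebra.algebraMap_eq_smul_one] using hc.isSelfAdjoint.le_algebraMap_norm_self
  refine h1.trans ((smul_le_smul_of_nonneg_right (by linarith) zero_le_one).trans
    (smul_le_smul_of_nonneg_left hz1 (by positivity)))

end InConjCone

lemma exists_mem_largeSet_conj_le {b s : A} {r μ : ℝ} {g : WeakDual ℂ A}
    (hg : g ∈ largeSet b r μ) (hs : IsSelfAdjoint s) (u : unitary A) :
    ∃ C : ℝ, 0 ≤ C ∧ ∃ g' ∈ largeSet b r μ, ∀ x, 0 ≤ x →
      (g (s * (star (u : A) * x * u) * s)).re ≤ C * (g' x).re := by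
  set t : ℝ := (‖s‖ + 1)⁻¹ with ht
  have ht0 : 0 < t := by positivity
  have hts : IsSelfAdjoint (t • s) := (IsSelfAdjoint.all t).smul hs
  have hn : ‖t • s‖ ≤ 1 := by
    rw [norm_smul, Real.norm_of_nonneg ht0.le, ht, inv_mul_le_iff₀ (by positivity)]
    linarith
  obtain ⟨w, hw, hw'⟩ := exists_unitary_of_selfAdjoint hts hn
  set γ := CFC.sqrt (1 - (t • s) ^ 2) with hγ
  have hγs : IsSelfAdjoint γ := (CFC.sqrt_nonneg _).isSelfAdjoint
  refine ⟨(t ^ 2)⁻¹, by positivity, (1 / 2 : ℝ) • adj (w * star u) g +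
    (1 / 2 : ℝ) • adj (star w * star u) g, convex_largeSet b r μ (adj_mem_largeSet hg _)
    (adj_mem_largeSet hg _) (by norm_num) (by norm_num) (by norm_num), fun x hx => ?_⟩
  set y := star (u : A) * x * u with hy
  have hy0 : 0 ≤ y := by simpa using star_right_conjugate_nonneg hx (star (u : A))
  have h1 := congrArg (fun v => (g v).re) (IsSelfAdjoint.sum_unitary_conj hw hw' y)
  have h2 := hg.1.re_nonneg (hγs.conj_nonneg hy0)
  simp only [map_add, Complex.add_re, WeakDual.map_real_smul, Complex.re_ofReal_mul,
    smul_mul_assoc, mul_smul_comm] at h1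
  rw [← div_eq_inv_mul, le_div_iff₀ (by positivity)]
  simp only [WeakDual.add_apply', WeakDual.real_smul_apply, Complex.add_re, Complex.re_ofReal_mul,
    adj_apply]
  have e1 : ((w * star u : unitary A) : A) * x * star ((w * star u : unitary A) : A) =
      w * y * star (w : A) := by
    simp [hy, mul_assoc]
  have e2 : ((star w * star u : unitary A) : A) * x * star ((star w * star u : unitary A) : A) =
      star (w : A) * y * w := by
    simp [hy, mul_assoc]
  rw [e1, e2]
  nlinarith

/-- If a trace is dominated by `g ∈ largeSet b r μ` on elements supported under `e`, then its
cutdown by any element of the cone generated by the conjugates of `h` is dominated by a member of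
`largeSet b r μ`. -/
lemma InConjCone.exists_mem_largeSet {b e h z : A} {r μ K : ℝ} {g τ : WeakDual ℂ A}
    (hg : g ∈ largeSet b r μ) (hτ : ∀ x y, τ (x * y) = τ (y * x)) (hh : 0 ≤ h)
    (hhe : h * (1 - e) = 0) (hK : 0 ≤ K)
    (hle : ∀ c, 0 ≤ c → c * (1 - e) = 0 → (τ c).re ≤ K * (g c).re) (hz : InConjCone h z) :
    ∃ C : ℝ, 0 ≤ C ∧ ∃ g' ∈ largeSet b r μ, ∀ x, 0 ≤ x →
      (τ (CFC.sqrt x * z * CFC.sqrt x)).re ≤ C * (g' x).re := by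
  induction hz with
  | zero => exact ⟨0, le_rfl, g, hg, fun x _ => by simp⟩
  | conj u =>
    set s := CFC.sqrt h with hs
    have hss : s * s = h := CFC.sqrt_mul_sqrt_self h hh
    have hsa : IsSelfAdjoint s := (CFC.sqrt_nonneg h).isSelfAdjoint
    have hse : s * (1 - e) = 0 := by
      rw [← CStarRing.star_mul_self_eq_zero_iff, star_mul, hsa.star_eq, mul_assoc, ← mul_assoc s,
        hss, hhe, mul_zero]
    obtain ⟨C, hC, g', hg', hle'⟩ := exists_mem_largeSet_conj_le hg hsa u
    refine ⟨K * C, by positivity, g', hg', fun x hx => ?_⟩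
    have hy0 : 0 ≤ star (u : A) * x * u := by
      simpa using star_right_conjugate_nonneg hx (star (u : A))
    have h1 : τ (CFC.sqrt x * ((u : A) * h * star (u : A)) * CFC.sqrt x) =
        τ (s * (star (u : A) * x * u) * s) := by
      have e1 : CFC.sqrt x * ((u : A) * h * star (u : A)) * CFC.sqrt x =
          (CFC.sqrt x * u * s) * (s * star (u : A) * CFC.sqrt x) := by
        simp only [← hss, mul_assoc]
      have e2 : s * (star (u : A) * x * u) * s =
          (s * star (u : A) * CFC.sqrt x) * (CFC.sqrt x * u * s) := by
        nth_rewrite 1 [← CFC.sqrt_mul_sqrt_self x hx]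
        simp only [mul_assoc]
      rw [e1, e2, hτ]
    rw [h1, mul_assoc K]
    exact (hle _ (hsa.conj_nonneg hy0) (by rw [mul_assoc, hse, mul_zero])).trans
      (mul_le_mul_of_nonneg_left (hle' x hx) hK)
  | add _ _ ih1 ih2 =>
    obtain ⟨C₁, hC₁, g₁, hg₁, h₁⟩ := ih1
    obtain ⟨C₂, hC₂, g₂, hg₂, h₂⟩ := ih2
    rcases (add_nonneg hC₁ hC₂).eq_or_lt with h0 | h0
    · refine ⟨0, le_rfl, g, hg, fun x hx => ?_⟩
      have e1 : C₁ = 0 := by linarith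
      have e2 : C₂ = 0 := by linarith
      have := h₁ x hx
      have := h₂ x hx
      rw [mul_add, add_mul, map_add, Complex.add_re]
      subst e1 e2
      linarith
    refine ⟨C₁ + C₂, h0.le, (C₁ / (C₁ + C₂)) • g₁ + (C₂ / (C₁ + C₂)) • g₂,
      convex_largeSet b r μ hg₁ hg₂ (by positivity) (by positivity)
        (by rw [← add_div, div_self h0.ne']), fun x hx => ?_⟩
    have := h₁ x hx
    have := h₂ x hx
    rw [mul_add, add_mul, map_add, Complex.add_re]
    simp only [WeakDual.add_apply', WeakDual.real_smul_apply, Complex.add_re,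
      Complex.re_ofReal_mul]
    have e3 : (C₁ + C₂) * (C₁ / (C₁ + C₂) * (g₁ x).re + C₂ / (C₁ + C₂) * (g₂ x).re) =
        C₁ * (g₁ x).re + C₂ * (g₂ x).re := by
      field_simp
    rw [e3]
    linarith
  | @smul t _ ht _ ih =>
    obtain ⟨C₁, hC₁, g₁, hg₁, h₁⟩ := ih
    refine ⟨t * C₁, by positivity, g₁, hg₁, fun x hx => ?_⟩
    rw [mul_smul_comm, smul_mul_assoc, WeakDual.map_real_smul, Complex.re_ofReal_mul,
      mul_assoc t C₁]
    exact mul_le_mul_of_nonneg_left (h₁ x hx) ht.le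

lemma exists_cutoffs {b : A} (hb : IsSelfAdjoint b) {ε : ℝ} (hε : 0 < ε) :
    ∃ e q : A, IsSelfAdjoint e ∧ IsSelfAdjoint q ∧
      cfc (fun t : ℝ => max (ε - t) 0) b * (1 - e) = 0 ∧ q * e = 0 ∧ b ≤ (2 * ε) • 1 + q := by
  have hc1 : Continuous fun t : ℝ => max 0 (min 1 (2 - t / ε)) := by fun_prop
  have hc2 : Continuous fun t : ℝ => max (t - 2 * ε) 0 := by fun_prop
  have hc3 : Continuous fun t : ℝ => max (ε - t) 0 := by fun_prop
  refine ⟨cfc (fun t : ℝ => max 0 (min 1 (2 - t / ε))) b, cfc (fun t : ℝ => max (t - 2 * ε) 0) b,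
    cfc_predicate _ b, cfc_predicate _ b, ?_, ?_, ?_⟩
  · rw [← cfc_one ℝ b, ← cfc_sub _ _ b continuous_one.continuousOn hc1.continuousOn,
      ← cfc_mul _ _ b hc3.continuousOn (by fun_prop), ← cfc_zero ℝ b]
    refine cfc_congr fun t _ => ?_
    rcases le_total ε t with h | h
    · simp [h]
    · have : t / ε ≤ 1 := (div_le_one hε).2 h
      simp [min_eq_left (show 1 ≤ 2 - t / ε by linarith)]
  · rw [← cfc_mul _ _ b hc2.continuousOn hc1.continuousOn, ← cfc_zero ℝ b]
    refine cfc_congr fun t _ => ?_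
    rcases le_total t (2 * ε) with h | h
    · simp [h]
    · have : 2 ≤ t / ε := (le_div_iff₀ hε).2 h
      simp [min_eq_right (show 2 - t / ε ≤ 1 by linarith),
        max_eq_left (show 2 - t / ε ≤ 0 by linarith)]
  · rw [← Algebra.algebraMap_eq_smul_one, ← cfc_const (2 * ε) b,
      ← cfc_add b _ _ continuousOn_const hc2.continuousOn]
    nth_rewrite 1 [← cfc_id' ℝ b]
    refine cfc_mono fun t _ => ?_
    linarith [le_max_left (t - 2 * ε) 0]

/-- If the positive part of `ε - b` generates `A` as an ideal for small `ε` and all traces vanish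
at `b`, then no state is bounded below by `r > 0` on all the unitary conjugates of `b`. -/
lemma not_nonempty_largeSet {b : A} (hb : IsSelfAdjoint b) {r : ℝ} (hr : 0 < r)
    (hτ : ∀ τ : WeakDual ℂ A, IsPos τ → (∀ x y, τ (x * y) = τ (y * x)) → τ b = 0)
    {z : A} (hz : InConjCone (cfc (fun t : ℝ => max (r / 4 - t) 0) b) z) (hz1 : 1 ≤ z) :
    ¬ (largeSet b r 1).Nonempty := by
  intro hne
  obtain ⟨μ, hμ, hne, htr⟩ := exists_largeSet_traceless hτ hne
  obtain ⟨e, q, he, hq, hhe, hqe, hbq⟩ := exists_cutoffs hb (ε := r / 4) (by positivity)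
  set h := cfc (fun t : ℝ => max (r / 4 - t) 0) b with hh_def
  have hh : 0 ≤ h := cfc_nonneg fun t _ => le_max_right _ _
  obtain ⟨g, hg, hmax⟩ := (isCompact_largeSet b r μ).exists_isMaxOn hne
    (f := fun g : WeakDual ℂ A => (g e).re)
    (Complex.continuous_re.comp (WeakDual.eval_continuous e)).continuousOn
  replace hmax : ∀ f ∈ largeSet b r μ, (f e).re ≤ (g e).re := fun f hf => hmax hf
  have hφ : IsPos (sandwich q q g) := fun x => by
    rw [sandwich_apply]
    have := hg.1 (x * q)
    rwa [star_mul, hq.star_eq, ← mul_assoc, mul_assoc q] at this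
  have hgb : ∀ c : A, c * (1 - e) = 0 → GramBound (sandwich q q g) c (‖q‖ ^ 2 * (g c).re) :=
    fun c hc => GramBound.of_isMaxOn hg hmax he hq hqe hc
  obtain ⟨τ, hτp, hτt, hτ1, hτM⟩ := exists_trace_of_gramBound hφ
    (hz.exists_gramBound_of_nonneg hh hz1 hφ (hgb h hhe))
  obtain ⟨C, hC, g', hg', hle⟩ := hz.exists_mem_largeSet hg hτt hh hhe (by positivity)
    (fun c hc hce => hτM c _ hc (hgb c hce))
  have hle' : ∀ x, 0 ≤ x → (τ x).re ≤ C * (g' x).re := by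
    intro x hx
    refine le_trans (hτp.mono ?_) (hle x hx)
    have := star_left_conjugate_le_conjugate hz1 (CFC.sqrt x)
    rwa [mul_one, (CFC.sqrt_nonneg x).isSelfAdjoint.star_eq, CFC.sqrt_mul_sqrt_self x hx] at this
  have hτ0 : (τ 1).re ≤ 0 := by
    rcases hC.eq_or_lt with h0 | h0
    · have := hle' 1 zero_le_one
      rwa [← h0, zero_mul] at this
    have h1 := htr g' hg' ((C⁻¹ : ℝ) • τ) (fun x => ?_) (fun x y => ?_) (fun x => ?_)
    · rw [WeakDual.real_smul_apply, Complex.re_ofReal_mul] at h1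
      exact nonpos_of_mul_nonpos_right h1 (inv_pos.2 h0)
    · rw [WeakDual.real_smul_apply]
      exact mul_nonneg (by exact_mod_cast inv_nonneg.2 h0.le) (hτp x)
    · rw [WeakDual.real_smul_apply, WeakDual.real_smul_apply, hτt]
    · have h2 := hle' _ (star_mul_self_nonneg x)
      rw [WeakDual.sub_apply', WeakDual.real_smul_apply,
        hg'.1.eq_re (IsSelfAdjoint.star_mul_self x), hτp.eq_re (IsSelfAdjoint.star_mul_self x)]
      rw [← Complex.ofReal_mul, ← Complex.ofReal_sub]
      have : C⁻¹ * (τ (star x * x)).re ≤ (g' (star x * x)).re := by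
        rwa [inv_mul_le_iff₀ h0]
      exact_mod_cast sub_nonneg.2 this
  have hq2 : (g (star q * q)).re ≤ 0 := by
    rw [hq.star_eq]
    have : (sandwich q q g 1).re ≤ 0 := hτ1.trans hτ0
    rwa [sandwich_apply, mul_one] at this
  have hgq : g q = 0 := by
    have := hg.1.dom_self.norm_apply_star_mul_le q 1
    rw [star_one, one_mul, Real.sqrt_eq_zero_of_nonpos hq2, mul_zero, zero_mul] at this
    exact norm_le_zero_iff.1 this
  have h1 := hg.2.2 1
  have h2 := hg.1.mono hbq
  rw [map_add, WeakDual.map_real_smul, hgq, add_zero, Complex.re_ofReal_mul, hg.2.1] at h2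
  simp only [OneMemClass.coe_one, one_mul, star_one, mul_one] at h1
  nlinarith

/-- If the cone generated by the conjugates of `h` contains no element above `1`, there is a state
vanishing on all these conjugates. -/
lemma exists_state_of_forall_not_one_le {h : A} (hh : 0 ≤ h)
    (hno : ∀ z, InConjCone h z → ¬ 1 ≤ z) :
    ∃ φ : WeakDual ℂ A, IsPos φ ∧ (φ 1).re = 1 ∧
      ∀ u : unitary A, (φ ((u : A) * h * star (u : A))).re = 0 := by
  let C : PointedCone ℝ A :=
    { carrier := {x | ∃ z, InConjCone h z ∧ -z ≤ x + star x}
      add_mem' := by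
        rintro x y ⟨z, hz, hx⟩ ⟨z', hz', hy⟩
        refine ⟨z + z', hz.add hz', ?_⟩
        rw [neg_add, star_add, add_add_add_comm]
        exact add_le_add hx hy
      zero_mem' := ⟨0, .zero, by simp⟩
      smul_mem' := by
        rintro ⟨t, ht⟩ x ⟨z, hz, hx⟩
        change ∃ z, InConjCone h z ∧ -z ≤ t • x + star (t • x)
        rcases ht.eq_or_lt with rfl | ht'
        · exact ⟨0, .zero, by simp⟩
        · refine ⟨t • z, hz.smul ht', ?_⟩
          rw [star_smul, star_trivial, ← smul_add, ← smul_neg]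
          exact smul_le_smul_of_nonneg_left hx ht }
  have hmem : ∀ x, x ∈ C ↔ ∃ z, InConjCone h z ∧ -z ≤ x + star x := fun x => Iff.rfl
  obtain ⟨φ, hφ1, hφC⟩ := exists_linear_nonneg_of_orderUnit C 1 (fun x => by
      refine ⟨‖x + star x‖, (hmem _).2 ⟨0, .zero, ?_⟩⟩
      have h1 := (IsSelfAdjoint.add_star_self x).neg_algebraMap_norm_le_self
      rw [Algebra.algebraMap_eq_smul_one, neg_le_iff_add_nonneg] at h1
      have h2 : (0 : A) ≤ ‖x + star x‖ • 1 := smul_nonneg (norm_nonneg _) zero_le_one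
      rw [neg_zero]
      refine (add_nonneg h1 h2).trans_eq ?_
      rw [star_add, star_smul, star_trivial ‖x + star x‖, star_one]
      generalize ‖x + star x‖ = t
      abel) (by
      rintro ⟨z, hz, hle⟩
      refine hno ((1 / 2 : ℝ) • z) (hz.smul (by norm_num)) ?_
      rw [star_neg, star_one, ← neg_add, neg_le_neg_iff] at hle
      have := smul_le_smul_of_nonneg_left hle (by norm_num : (0 : ℝ) ≤ 1 / 2)
      rwa [← two_smul ℝ (1 : A), smul_smul, one_div, inv_mul_cancel₀ two_ne_zero, one_smul,
        ← one_div] at this)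
  have hpos : ∀ x, 0 ≤ x → 0 ≤ φ x := fun x hx => hφC x <| (hmem x).2 ⟨0, .zero, by
    rw [neg_zero, hx.isSelfAdjoint.star_eq]; exact add_nonneg hx hx⟩
  obtain ⟨f, hf, hfφ⟩ := exists_isPos_of_real φ hpos fun x hx => by
    have h1 := hφC x ((hmem x).2 ⟨0, .zero, by rw [hx]; simp⟩)
    have h2 := hφC (-x) ((hmem _).2 ⟨0, .zero, by rw [star_neg, hx]; simp⟩)
    rw [map_neg] at h2
    linarith
  refine ⟨f, hf, by rw [hfφ, hφ1], fun u => ?_⟩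
  rw [hfφ]
  have h0 := star_right_conjugate_nonneg hh (u : A)
  refine le_antisymm ?_ (hpos _ h0)
  have := hφC (-((u : A) * h * star (u : A))) ((hmem _).2
    ⟨_, (InConjCone.conj u).add (InConjCone.conj u), by
      rw [star_neg, h0.isSelfAdjoint.star_eq, neg_add]⟩)
  rw [map_neg] at this
  linarith

lemma apply_conj_eq_zero {h : A} (hh : 0 ≤ h) {φ : WeakDual ℂ A} (hφ : IsPos φ)
    (h0 : ∀ u : unitary A, (φ ((u : A) * h * star (u : A))).re = 0) (x : A) :
    (φ (star (CFC.sqrt h * x) * (CFC.sqrt h * x))).re = 0 := by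
  have hs : star (CFC.sqrt h) = CFC.sqrt h := (CFC.sqrt_nonneg h).isSelfAdjoint.star_eq
  have hx : x ∈ Submodule.span ℂ (unitary A : Set A) := by
    rw [CStarAlgebra.span_unitary]; trivial
  induction hx using Submodule.span_induction with
  | mem u hu =>
    have := h0 (star ⟨u, hu⟩)
    rw [Unitary.coe_star, star_star] at this
    rwa [star_mul, hs, mul_assoc, ← mul_assoc _ _ u, CFC.sqrt_mul_sqrt_self h hh, ← mul_assoc]
  | zero => simp
  | add x y _ _ hx hy =>
    have h1 := hφ.dom_self.norm_apply_star_mul_le (CFC.sqrt h * x) (CFC.sqrt h * y)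
    have h2 := hφ.dom_self.norm_apply_star_mul_le (CFC.sqrt h * y) (CFC.sqrt h * x)
    rw [hx, hy, Real.sqrt_zero, mul_zero, norm_le_zero_iff] at h1 h2
    rw [mul_add, star_add, add_mul, mul_add, mul_add]
    simp only [map_add, Complex.add_re, hx, hy, h1, h2]
    simp
  | smul t x _ hx =>
    have h1 := hφ.dom_self.norm_apply_star_mul_le (CFC.sqrt h * x) (CFC.sqrt h * x)
    rw [hx, Real.sqrt_zero, mul_zero, norm_le_zero_iff] at h1
    rw [mul_smul_comm, star_smul, smul_mul_assoc, mul_smul_comm, map_smul, map_smul, h1]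
    simp

end order

lemma StarAlgHom.exists_apply_eq_norm_le {B : Type u} [CStarAlgebra B] (π : A →⋆ₐ[ℂ] B) (a : A) :
    ∃ a', π a' = π a ∧ ‖a'‖ ≤ ‖π a‖ := by
  let := CStarAlgebra.spectralOrder A
  let := CStarAlgebra.spectralOrderedRing A
  let := CStarAlgebra.spectralOrder B
  let := CStarAlgebra.spectralOrderedRing B
  rcases eq_or_ne (π a) 0 with h0 | h0
  · exact ⟨0, by simp [h0]⟩
  have : Nontrivial B := nontrivial_of_ne _ _ h0
  set M := ‖π a‖ with hM
  have hM0 : 0 < M := norm_pos_iff.2 h0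
  set f : ℝ → ℝ := fun t => M / max M √t with hf
  have hfc : Continuous f := continuous_const.div (by fun_prop) fun t =>
    (lt_max_of_lt_left hM0).ne'
  have hsa := IsSelfAdjoint.star_mul_self a
  have hπ : Continuous π := map_continuous π
  refine ⟨a * cfc f (star a * a), ?_, ?_⟩
  · have h1 : cfc f (star (π a) * π a) = 1 := by
      rw [← cfc_one ℝ (star (π a) * π a) (IsSelfAdjoint.star_mul_self _)]
      refine cfc_congr fun t ht => ?_
      have h2 : t ≤ M ^ 2 := by
        have := (Real.le_norm_self t).trans (spectrum.norm_le_norm_of_mem ht)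
        rwa [CStarRing.norm_star_mul_self, ← sq] at this
      have h3 : √t ≤ M := Real.sqrt_le_iff.2 ⟨hM0.le, h2⟩
      simp [hf, max_eq_left h3, hM0.ne']
    rw [map_mul, StarAlgHomClass.map_cfc π f _ hfc.continuousOn hπ hsa
      (hsa.map π), map_mul, map_star, h1, mul_one]
  · have h4 : IsSelfAdjoint (cfc f (star a * a)) := cfc_predicate _ _
    have h2 : star (a * cfc f (star a * a)) * (a * cfc f (star a * a)) =
        cfc (fun t => f t * t * f t) (star a * a) := by
      rw [cfc_mul _ _ _ (by fun_prop) (by fun_prop), cfc_mul _ _ _ (by fun_prop) (by fun_prop),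
        cfc_id' ℝ (star a * a), star_mul, h4.star_eq]
      simp only [mul_assoc]
    have h3 : ‖cfc (fun t => f t * t * f t) (star a * a)‖ ≤ M ^ 2 := by
      refine norm_cfc_le (by positivity) fun t ht => ?_
      have ht0 : 0 ≤ t := spectrum_nonneg_of_nonneg (star_mul_self_nonneg a) ht
      have h5 : 0 < max M √t := lt_max_of_lt_left hM0
      have h6 : t ≤ max M √t ^ 2 := by
        calc t = √t ^ 2 := (Real.sq_sqrt ht0).symm
          _ ≤ _ := by gcongr; exact le_max_right _ _
      have h7 : 0 ≤ f t := by positivity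
      rw [Real.norm_of_nonneg (by positivity)]
      calc f t * t * f t = M ^ 2 * (t / max M √t ^ 2) := by simp only [hf]; ring
        _ ≤ M ^ 2 * 1 := by gcongr; exact (div_le_one (by positivity)).2 h6
        _ = M ^ 2 := mul_one _
    rw [← h2, CStarRing.norm_star_mul_self, ← sq] at h3
    exact (pow_le_pow_iff_left₀ (norm_nonneg _) hM0.le two_ne_zero).1 h3

/-- The range of a star homomorphism of C*-algebras is closed. -/
lemma StarAlgHom.isClosed_range {B : Type u} [CStarAlgebra B] (π : A →⋆ₐ[ℂ] B) :
    IsClosed (π.range : Set B) := by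
  let f : NormedAddGroupHom A B := AddMonoidHom.mkNormedAddGroupHom (π : A →+ B) 1 fun x => by
    rw [one_mul]; exact NonUnitalStarAlgHom.norm_apply_le π x
  have hf : ∀ x, f x = π x := fun x => rfl
  have hK : f.SurjectiveOnWith f.range 1 := by
    rintro _ ⟨a, rfl⟩
    obtain ⟨a', h1, h2⟩ := π.exists_apply_eq_norm_le a
    exact ⟨a', h1, by rw [one_mul]; exact h2⟩
  have hcl := controlled_closure_of_complete one_pos one_pos hK
  have hr : (π.range : Set B) = (f.range : Set B) := by
    ext y
    exact Iff.rfl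
  rw [hr]
  refine isClosed_of_closure_subset fun y hy => ?_
  obtain ⟨x, hx, -⟩ := hcl y hy
  exact ⟨x, hx⟩

lemma StarAlgHom.exists_surjective {B : Type u} [CStarAlgebra B] (π : A →⋆ₐ[ℂ] B) :
    ∃ (C : Type u) (_ : CStarAlgebra C) (ρ : A →⋆ₐ[ℂ] C), Function.Surjective ρ ∧
      ∀ x, ρ x = 0 ↔ π x = 0 := by
  have : IsClosed (π.range : Set B) := π.isClosed_range
  exact ⟨π.range, inferInstance, π.rangeRestrict, fun ⟨_, x, hx⟩ => ⟨x, Subtype.ext hx⟩, fun x =>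
    Subtype.ext_iff⟩

section order

variable [PartialOrder A] [StarOrderedRing A]

/-- The GNS representation of a state vanishing on all conjugates of `h` kills `h`. -/
lemma exists_quotient_apply_eq_zero {h : A} (hh : 0 ≤ h) {φ : WeakDual ℂ A} (hφ : IsPos φ)
    (hφ1 : (φ 1).re = 1) (h0 : ∀ u : unitary A, (φ ((u : A) * h * star (u : A))).re = 0) :
    ∃ (B : Type u) (_ : CStarAlgebra B) (ρ : A →⋆ₐ[ℂ] B), Function.Surjective ρ ∧
      Nontrivial B ∧ ρ h = 0 := by
  let f : A →ₚ[ℂ] ℂ := PositiveLinearMap.mk₀ (φ : A →ₗ[ℂ] ℂ) fun x hx => hφ.nonneg hx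
  have hf : ∀ x, f x = φ x := fun x => rfl
  have hs : f.gnsStarAlgHom (CFC.sqrt h) = 0 := by
    ext y
    induction y using UniformSpace.Completion.induction_on with
    | hp => exact isClosed_eq (by fun_prop) (by fun_prop)
    | ih y =>
      change f.gnsNonUnitalStarAlgHom (CFC.sqrt h) y = 0
      rw [PositiveLinearMap.gnsNonUnitalStarAlgHom_apply_coe, ← norm_eq_zero,
        UniformSpace.Completion.norm_coe,
        PositiveLinearMap.preGNS_norm_def, hf]
      have := apply_conj_eq_zero hh hφ h0 (f.ofPreGNS y)
      rw [← Real.sqrt_zero, ← this]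
      rfl
  have h1 : f.gnsStarAlgHom h = 0 := by
    rw [← CFC.sqrt_mul_sqrt_self h hh, map_mul, hs, zero_mul]
  obtain ⟨B, hB, ρ, hρ, hρ0⟩ := f.gnsStarAlgHom.exists_surjective
  refine ⟨B, hB, ρ, hρ, nontrivial_of_ne (ρ 1) 0 fun h2 => ?_, (hρ0 h).2 h1⟩
  rw [hρ0, map_one] at h2
  have h3 : ‖f.toPreGNS 1‖ = 0 := by
    rw [← UniformSpace.Completion.norm_coe, norm_eq_zero]
    exact (DFunLike.congr_fun h2 ((f.toPreGNS 1 : f.PreGNS) : f.GNS) :)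
  rw [PositiveLinearMap.preGNS_norm_def, f.ofPreGNS_toPreGNS, hf, star_one, mul_one, hφ1,
    Real.sqrt_one] at h3
  exact one_ne_zero h3

end order

lemma realPart'_isSelfAdjoint (w : ℂ) (a : A) : IsSelfAdjoint (realPart' w a) := by
  rw [realPart', IsSelfAdjoint, star_smul, star_add, star_star, add_comm]
  simp

lemma realPart'_neg (w : ℂ) (a : A) : realPart' (-w) a = - realPart' w a := by
  rw [realPart', realPart', neg_smul, star_neg, ← neg_add, smul_neg]

lemma IsSelfAdjoint.spectrum_subset_Ici_of_cfc_eq_zero {b : A} (hb : IsSelfAdjoint b) {ε : ℝ}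
    (h : cfc (fun t : ℝ => max (ε - t) 0) b = 0) : spectrum ℝ b ⊆ Set.Ici ε := by
  intro t ht
  have h1 : max (ε - t) 0 ∈ spectrum ℝ (cfc (fun t : ℝ => max (ε - t) 0) b) := by
    rw [cfc_map_spectrum _ _ (hf := by fun_prop)]
    exact ⟨t, ht, rfl⟩
  have : Nontrivial A := by
    by_contra hn
    rw [not_nontrivial_iff_subsingleton] at hn
    simp [spectrum.of_subsingleton] at ht
  rw [h, spectrum.zero_eq, Set.mem_singleton_iff, max_eq_right_iff, sub_nonpos] at h1
  exact h1

section order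

variable [PartialOrder A] [StarOrderedRing A]

lemma exists_inConjCone_one_le {a : A} {z : ℂ} {ε : ℝ} (hε : 0 < ε)
    (hB : ∀ (B : Type u) [CStarAlgebra B], ∀ π : A →⋆ₐ[ℂ] B, Function.Surjective π →
      Nontrivial B → ∀ w : ℂ, ¬ (IsUnit (π (realPart' w a)) ∧
        spectrum ℝ (π (realPart' w a)) ⊆ Set.Iio (0 : ℝ))) :
    ∃ x, InConjCone (cfc (fun t : ℝ => max (ε - t) 0) (realPart' z a)) x ∧ 1 ≤ x := by
  by_contra! hno
  have hh : 0 ≤ cfc (fun t : ℝ => max (ε - t) 0) (realPart' z a) :=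
    cfc_nonneg fun t _ => le_max_right _ _
  obtain ⟨φ, hφ, hφ1, hφ0⟩ := exists_state_of_forall_not_one_le hh hno
  obtain ⟨B, hB', ρ, hρ, hnt, hρ0⟩ := exists_quotient_apply_eq_zero hh hφ hφ1 hφ0
  have hsa := realPart'_isSelfAdjoint z a
  have hρc : Continuous ρ := AddMonoidHomClass.continuous_of_bound ρ 1 fun x => by
    rw [one_mul]; exact NonUnitalStarAlgHom.norm_apply_le ρ x
  rw [StarAlgHomClass.map_cfc ρ _ _ (by fun_prop) hρc hsa (hsa.map ρ)] at hρ0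
  have hsp := (hsa.map ρ).spectrum_subset_Ici_of_cfc_eq_zero hρ0
  have h1 : spectrum ℝ (ρ (realPart' (-z) a)) ⊆ Set.Iio 0 := by
    rw [realPart'_neg, map_neg, ← spectrum.neg_eq]
    intro t ht
    have := hsp (Set.mem_neg.1 ht)
    simp only [Set.mem_Ici, Set.mem_Iio] at this ⊢
    linarith
  refine hB B ρ hρ hnt (-z) ⟨?_, h1⟩
  rw [← spectrum.zero_notMem_iff ℝ]
  exact fun h => lt_irrefl (0 : ℝ) (h1 h)

end order

/-- Membership in a closed convex set containing all unitary conjugates. -/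
lemma mem_of_mem_dixmierSet {a d : A} (hd : d ∈ dixmierSet a) {s : Set A} (hs : IsClosed s)
    (hc : Convex ℝ s) (hu : ∀ u : unitary A, (u : A) * a * star (u : A) ∈ s) : d ∈ s :=
  closure_minimal (convexHull_min (by rintro _ ⟨u, rfl⟩; exact hu u) hc) hs hd

lemma realPart'_conj (w : ℂ) (a : A) (u : unitary A) :
    realPart' w ((u : A) * a * star (u : A)) = (u : A) * realPart' w a * star (u : A) := by
  simp only [realPart', star_smul, star_mul, star_star, mul_smul_comm, smul_mul_assoc, mul_add,
    add_mul, mul_assoc]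

lemma realPart'_add (w : ℂ) (a b : A) : realPart' w (a + b) = realPart' w a + realPart' w b := by
  simp only [realPart', smul_add, star_add]
  abel

lemma realPart'_real_smul (w : ℂ) (t : ℝ) (a : A) : realPart' w (t • a) = t • realPart' w a := by
  simp only [realPart', star_smul, star_trivial, smul_add, smul_comm t]

lemma continuous_realPart' (w : ℂ) : Continuous (realPart' w : A → A) := by
  unfold realPart'
  fun_prop

lemma apply_eq_zero_of_zero_mem_dixmierSet {a : A} (h : (0 : A) ∈ dixmierSet a)
    {τ : A →L[ℂ] ℂ} (hτ : ∀ x y, τ (x * y) = τ (y * x)) : τ a = 0 := by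
  have hc : Convex ℝ {x : A | τ x = τ a} := by
    intro x hx y hy s t _ _ hst
    have hτs : ∀ (s : ℝ) x, τ (s • x) = s * τ x := fun s x => by
      rw [← Complex.coe_smul, map_smul, smul_eq_mul]
    change τ (s • x + t • y) = τ a
    rw [map_add, hτs, hτs, show τ x = τ a from hx,
      show τ y = τ a from hy, ← add_mul, ← Complex.ofReal_add, hst, Complex.ofReal_one, one_mul]
  have := mem_of_mem_dixmierSet h (isClosed_eq τ.continuous continuous_const) hc fun u => by
    change τ _ = τ a
    rw [hτ, ← mul_assoc, Unitary.star_mul_self_of_mem u.2, one_mul]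
  rw [← show τ 0 = τ a from this, map_zero]

lemma not_spectrum_subset_Iio_of_zero_mem_dixmierSet {a : A} (h : (0 : A) ∈ dixmierSet a)
    {B : Type u} [CStarAlgebra B] [Nontrivial B] (π : A →⋆ₐ[ℂ] B) (w : ℂ) :
    ¬ spectrum ℝ (π (realPart' w a)) ⊆ Set.Iio (0 : ℝ) := by
  intro hsp
  let := CStarAlgebra.spectralOrder B
  let := CStarAlgebra.spectralOrderedRing B
  have hπ : Continuous π := AddMonoidHomClass.continuous_of_bound π 1 fun x => by
    rw [one_mul]
    exact NonUnitalStarAlgHom.norm_apply_le π x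
  have hsa : IsSelfAdjoint (π (realPart' w a)) := (realPart'_isSelfAdjoint w a).map π
  obtain ⟨m, hm, hmax⟩ := (spectrum.isCompact (𝕜 := ℝ) (π (realPart' w a))).exists_isMaxOn
    (ContinuousFunctionalCalculus.spectrum_nonempty _ hsa) continuousOn_id
  have hm0 : m < 0 := hsp hm
  have hle : π (realPart' w a) ≤ m • 1 := by
    rw [← Algebra.algebraMap_eq_smul_one]
    exact le_algebraMap_of_spectrum_le fun t ht => hmax ht
  have hcl : IsClosed {x : A | 0 ≤ m • 1 - π (realPart' w x)} :=
    CStarAlgebra.isClosed_nonneg.preimage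
      (continuous_const.sub (hπ.comp (continuous_realPart' w)))
  have hcv : Convex ℝ {x : A | 0 ≤ m • 1 - π (realPart' w x)} := by
    intro x hx y hy s t hs ht hst
    have hπs : ∀ (s : ℝ) x, π (s • x) = s • π x := fun s x => by
      rw [← Complex.coe_smul, map_smul, Complex.coe_smul]
    replace hx : 0 ≤ m • 1 - π (realPart' w x) := hx
    replace hy : 0 ≤ m • 1 - π (realPart' w y) := hy
    change 0 ≤ m • 1 - π (realPart' w (s • x + t • y))
    refine (add_nonneg (smul_nonneg hs hx) (smul_nonneg ht hy)).trans_eq ?_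
    rw [realPart'_add, realPart'_real_smul, realPart'_real_smul, map_add, hπs, hπs, smul_sub,
      smul_sub, sub_add_sub_comm, ← add_smul, hst, one_smul]
  have h1 := mem_of_mem_dixmierSet h hcl hcv fun u => by
    change 0 ≤ m • 1 - π (realPart' w (u * a * star (u : A)))
    rw [realPart'_conj]
    have h2 := star_right_conjugate_nonneg (sub_nonneg.2 hle) (π u)
    have h3 : π u * star (π u) = 1 := by
      rw [← map_star, ← map_mul, Unitary.mul_star_self_of_mem u.2, map_one]
    refine h2.trans_eq ?_
    rw [mul_sub, sub_mul, mul_smul_comm, smul_mul_assoc, mul_one, h3, map_mul, map_mul, map_star]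
  have h0 : realPart' w (0 : A) = 0 := by simp [realPart']
  change 0 ≤ m • 1 - π (realPart' w 0) at h1
  rw [h0, map_zero, sub_zero] at h1
  have h4 : (0 : B) ≤ (-m) • 1 := smul_nonneg (by linarith) zero_le_one
  rw [neg_smul, Left.nonneg_neg_iff] at h4
  exact (smul_ne_zero hm0.ne one_ne_zero) (le_antisymm h4 h1)

section order

variable [PartialOrder A] [StarOrderedRing A]

lemma IsPos.apply_realPart' {l : WeakDual ℂ A} (hl : IsPos l) (w : ℂ) (x : A) :
    l (realPart' w x) = ((w * l x).re : ℂ) := by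
  rw [realPart', map_smul, map_add, hl.map_star, map_smul, smul_eq_mul, smul_eq_mul,
    Complex.star_def, Complex.add_conj]
  push_cast
  ring

lemma mem_largeSet_realPart' {a : A} {l : WeakDual ℂ A} {z : ℂ} {r : ℝ} (hl : IsPos l)
    (hl1 : l 1 = 1) (h : ∀ u : unitary A, r ≤ (z * l ((u : A) * a * star (u : A))).re) :
    l ∈ largeSet (realPart' z a) r 1 :=
  ⟨hl, by rw [hl1, Complex.one_re], fun u => by
    rw [← realPart'_conj, hl.apply_realPart', Complex.ofReal_re]
    exact h u⟩

end order

lemma apply_eq_zero_of_forall_isTracialState {a : A}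
    (h : ∀ τ : A →L[ℂ] ℂ, IsTracialState τ → τ a = 0) {τ : WeakDual ℂ A} (hτ : IsPos τ)
    (htr : ∀ x y, τ (x * y) = τ (y * x)) : τ a = 0 := by
  set σ : A →L[ℂ] ℂ := WeakDual.toStrongDual τ with hσ
  have hστ : ∀ x, σ x = τ x := fun x => rfl
  rcases eq_or_ne σ 0 with h0 | h0
  · rw [← hστ, h0, zero_apply]
  have hn : ‖σ‖ ≠ 0 := norm_ne_zero_iff.2 h0
  have h1 : ∀ x, ((‖σ‖⁻¹ : ℝ) • σ) x = ((‖σ‖⁻¹ : ℝ) : ℂ) * τ x := fun x => by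
    rw [smul_apply, hστ, Complex.real_smul]
  have h2 := h ((‖σ‖⁻¹ : ℝ) • σ) ⟨by rw [norm_smul, norm_inv, norm_norm, inv_mul_cancel₀ hn],
    fun x => by
      rw [h1]
      exact mul_nonneg (by exact_mod_cast inv_nonneg.2 (norm_nonneg σ)) (hτ x),
    fun x y => by rw [h1, h1, htr]⟩
  rw [h1] at h2
  exact (mul_eq_zero.1 h2).resolve_left (by exact_mod_cast inv_ne_zero hn)

/-- **Theorem 5.4.**  For `a` in a unital C*-algebra `A`, `0 ∈ D_A(a)` iff (a) every tracial
state of `A` vanishes on `a`, and (b) in no nonzero quotient of `A` is the image of `Re(wa)`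
(for `w ∈ ℂ`) invertible with negative spectrum.  Quotients of `A` by proper closed
two-sided ideals are represented by surjective star-algebra homomorphisms `π : A → B` onto
nonzero C*-algebras. -/
theorem zero_mem_dixmierSet_iff (A : Type u) [CStarAlgebra A] (a : A) :
    (0 : A) ∈ dixmierSet a ↔
      ((∀ τ : A →L[ℂ] ℂ, IsTracialState τ → τ a = 0) ∧
       (∀ (B : Type u) [CStarAlgebra B], ∀ π : A →⋆ₐ[ℂ] B, Function.Surjective π →
          Nontrivial B → ∀ w : ℂ,
            ¬ (IsUnit (π (realPart' w a)) ∧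
               spectrum ℝ (π (realPart' w a)) ⊆ Set.Iio (0 : ℝ)))) := by
  refine ⟨fun h => ⟨fun τ hτ => apply_eq_zero_of_zero_mem_dixmierSet h hτ.2.2,
    fun B _ π _ _ w hw => not_spectrum_subset_Iio_of_zero_mem_dixmierSet h π w hw.2⟩, ?_⟩
  rintro ⟨hT, hB⟩
  let := CStarAlgebra.spectralOrder A
  let := CStarAlgebra.spectralOrderedRing A
  by_contra h
  obtain ⟨l, z, r, hl, hl1, hr, hlr⟩ := exists_state_of_zero_notMem h
  obtain ⟨x, hx, hx1⟩ := exists_inConjCone_one_le (z := z) (by positivity : 0 < r / 4) hB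
  refine not_nonempty_largeSet (realPart'_isSelfAdjoint z a) hr (fun τ hτ htr => ?_) hx hx1
    ⟨l, mem_largeSet_realPart' hl hl1 hlr⟩
  rw [hτ.apply_realPart', apply_eq_zero_of_forall_isTracialState hT hτ htr, mul_zero,
    Complex.zero_re, Complex.ofReal_zero]

end
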